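/- arXiv:2507.00326 — 2 statements merged into one kernel-verified Lean document; each statement's English description precedes it below -/
import Mathlib

section
/- Under Hypothesis H, with Z a non-negative integer such that Z < n and no row of M has more than Z vanishing entries, the function (s,w) ↦ 𝒵_{N,n}(s,w,M) has a meromorphic continuation to ℂ × {w ∈ ℂ^n : Re(w_k) > 0, 1 ≤ k ≤ n}; for each such fixed w the function s ↦ 𝒵_{N,n}(s,w,M) has poles of order at most Z+1, and its poles can occur only at rational numbers s̃ ≤ N/(n − Z) of the form s̃ = a/b with a, b ∈ ℤ and n − Z ≤ b ≤ n. Moreover 𝒵_{N,n}(s,w,M) is analytic at (−ℓ, w) for every non-negative integer ℓ and every w ∈ ℂ^n with Re(w_k) > 0 (1 ≤ k ≤ n). -/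
open MeasureTheory Complex
open scoped Classical

noncomputable section

/-- Hypothesis H: each entry of the matrix either vanishes or has positive real part,
and no row vanishes. -/
def HypH {N n : ℕ} (a : Fin N → Fin n → ℂ) : Prop :=
  (∀ i j, a i j = 0 ∨ 0 < (a i j).re) ∧ ∀ i, ∃ j, a i j ≠ 0

/-- The Shintani–Barnes zeta integral `𝒵_{N,n}(s,w,M)`. -/
def zetaIntegral {N n : ℕ} (a : Fin N → Fin n → ℂ) (s : ℂ) (w : Fin n → ℂ) : ℂ :=
  ∫ t in {t : Fin N → ℝ | ∀ i, 0 < t i}, ∏ j, (w j + ∑ i, (t i : ℂ) * a i j) ^ (-s)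

section

open Metric Set Filter Topology
open scoped Pointwise

lemma torusMap_mem_closedBall {d : ℕ} (c : Fin d → ℂ) {r : ℝ} (hr : 0 < r) (θ : Fin d → ℝ) :
    torusMap c (fun _ => r) θ ∈ closedBall c r := by
  rw [mem_closedBall, dist_pi_le_iff hr.le]
  intro i
  simp [torusMap, dist_eq_norm, abs_of_pos hr]

lemma torusMap_sub_ne_zero {d : ℕ} {c z : Fin d → ℂ} {r : ℝ} (hr : 0 < r) (hz : z ∈ ball c r)
    (θ : Fin d → ℝ) (i : Fin d) : torusMap c (fun _ => r) θ i - z i ≠ 0 := by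
  intro h
  have h1 : dist (z i) (c i) < r := (dist_pi_lt_iff hr).1 hz i
  rw [← sub_eq_zero.1 h] at h1
  simp [torusMap, dist_eq_norm, abs_of_pos hr] at h1

lemma continuous_torusMap {d : ℕ} (c : Fin d → ℂ) (R : Fin d → ℝ) :
    Continuous (torusMap c R) := by
  unfold torusMap
  fun_prop

lemma continuous_torusMap_apply {d : ℕ} (c : Fin d → ℂ) (R : Fin d → ℝ) (i : Fin d) :
    Continuous fun θ => torusMap c R θ i :=
  (continuous_apply i).comp (continuous_torusMap c R)

lemma torusIntegral_cauchy {d : ℕ} (f : (Fin d → ℂ) → ℂ) (c : Fin d → ℂ) {r : ℝ} (hr : 0 < r)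
    (hc : ContinuousOn f (closedBall c r))
    (hd : ∀ x ∈ closedBall c r, ∀ i,
      DifferentiableOn ℂ (fun z => f (Function.update x i z)) (ball (c i) r))
    {z : Fin d → ℂ} (hz : z ∈ ball c r) :
    torusIntegral (fun ζ => (∏ i, (ζ i - z i)⁻¹) * f ζ) c (fun _ => r)
      = (2 * Real.pi * I) ^ d * f z := by
  induction d with
  | zero =>
    simp
    congr 1
    exact Subsingleton.elim _ _
  | succ d ih =>
    have hint : TorusIntegrable (fun ζ => (∏ i, (ζ i - z i)⁻¹) * f ζ) c (fun _ => r) := by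
      apply Continuous.integrableOn_Icc
      apply Continuous.mul
      · refine continuous_finsetProd _ fun i _ => ?_
        refine Continuous.inv₀ ?_ (fun θ => torusMap_sub_ne_zero hr hz θ i)
        exact (continuous_torusMap_apply c _ i).sub continuous_const
      · exact hc.comp_continuous (continuous_torusMap c _) (torusMap_mem_closedBall c hr)
    have hcons : ∀ x ∈ closedBall (c 0) r, ∀ y ∈ closedBall (c ∘ Fin.succ) r,
        (Fin.cons x y : Fin (d + 1) → ℂ) ∈ closedBall c r := by
      intro x hx y hy
      rw [mem_closedBall, dist_pi_le_iff hr.le] at hy ⊢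
      intro i
      refine Fin.cases ?_ (fun j => ?_) i
      · simpa using hx
      · simpa using hy j
    have hz' : z ∘ Fin.succ ∈ ball (c ∘ Fin.succ) r := by
      rw [mem_ball, dist_pi_lt_iff hr] at hz ⊢
      exact fun i => hz i.succ
    have hz0 : z 0 ∈ ball (c 0) r := by
      rw [mem_ball, dist_pi_lt_iff hr] at hz
      exact hz 0
    rw [torusIntegral_succ hint]
    have hinner : ∀ x ∈ sphere (c 0) r,
        torusIntegral (fun y => (∏ i, ((Fin.cons x y : Fin (d + 1) → ℂ) i - z i)⁻¹)
          * f (Fin.cons x y)) (c ∘ Fin.succ) (fun _ => r)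
        = (x - z 0)⁻¹ • ((2 * Real.pi * I) ^ d * f (Fin.cons x (z ∘ Fin.succ))) := by
      intro x hx
      have hx' := sphere_subset_closedBall hx
      rw [← ih (fun y => f (Fin.cons x y)) (c ∘ Fin.succ) ?_ ?_ hz', smul_eq_mul,
        ← torusIntegral_const_mul]
      · congr 1
        ext y
        rw [Fin.prod_univ_succ]
        simp [mul_assoc]
      · refine hc.comp (Continuous.continuousOn (by fun_prop)) fun y hy => hcons x hx' y hy
      · intro y hy i
        have := hd _ (hcons x hx' y hy) i.succ
        simpa [← Fin.cons_update] using this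
    rw [show ((fun _ : Fin (d + 1) => r) ∘ Fin.succ : Fin d → ℝ) = fun _ => r from rfl]
    rw [circleIntegral.integral_congr hr.le hinner]
    have hcz : z ∘ Fin.succ ∈ closedBall (c ∘ Fin.succ) r := ball_subset_closedBall hz'
    rw [circleIntegral_sub_inv_smul_of_differentiable_on_off_countable countable_empty hz0]
    · have : (Fin.cons (z 0) (z ∘ Fin.succ) : Fin (d + 1) → ℂ) = z := Fin.cons_self_tail z
      rw [this, smul_eq_mul]
      ring
    · apply ContinuousOn.mul continuousOn_const
      exact hc.comp (Continuous.continuousOn (by fun_prop)) fun x hx => hcons x hx _ hcz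
    · intro x hx
      have h1 := hd _ (hcons x (ball_subset_closedBall hx.1) _ hcz) 0
      have h2 : DifferentiableAt ℂ (fun x => f (Fin.cons x (z ∘ Fin.succ))) x := by
        have := (h1 x hx.1).differentiableAt (isOpen_ball.mem_nhds hx.1)
        simpa using this
      exact h2.const_mul _

lemma analyticAt_of_continuousOn_of_separately {d : ℕ} (f : (Fin d → ℂ) → ℂ) (c : Fin d → ℂ)
    {r : ℝ} (hr : 0 < r) (hc : ContinuousOn f (closedBall c r))
    (hd : ∀ x ∈ closedBall c r, ∀ i,
      DifferentiableOn ℂ (fun z => f (Function.update x i z)) (ball (c i) r)) :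
    AnalyticAt ℂ f c := by
  let S : Set (Fin d → ℝ) := Icc 0 (fun _ => 2 * Real.pi)
  have : CompactSpace S := isCompact_iff_compactSpace.1 isCompact_Icc
  have hSfin : IsFiniteMeasure (Measure.comap (Subtype.val : S → (Fin d → ℝ)) volume) := by
    refine ⟨?_⟩
    rw [(MeasurableEmbedding.subtype_coe measurableSet_Icc).comap_apply]
    simp only [image_univ, Subtype.range_coe_subtype, ofPred_mem_eq]
    exact measure_Icc_lt_top
  set μ := Measure.comap (Subtype.val : S → (Fin d → ℝ)) volume with hμ
  let A := C(S, ℂ)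
  have hint : ∀ φ : A, Integrable φ μ := fun φ =>
    (integrable_const ‖φ‖).mono' φ.continuous.aestronglyMeasurable
      (Eventually.of_forall fun x => φ.norm_coe_le_norm x)
  let Λ : A →L[ℂ] ℂ := LinearMap.mkContinuous
    { toFun := fun φ => ∫ x, φ x ∂μ
      map_add' := fun φ ψ => integral_add (hint φ) (hint ψ)
      map_smul' := fun a φ => integral_const_mul a _ } (μ.real univ) (fun φ => by
        refine (norm_integral_le_of_norm_le_const
          (Eventually.of_forall fun x => φ.norm_coe_le_norm x)).trans (le_of_eq (mul_comm _ _)))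
  let W : A := ⟨fun θ => (∏ i : Fin d, (r : ℂ) * exp (θ.1 i * I) * I) *
      f (torusMap c (fun _ => r) θ.1), by
    apply Continuous.mul
    · have : Continuous fun θ : Fin d → ℝ => ∏ i : Fin d, (r : ℂ) * exp (θ i * I) * I :=
        continuous_finsetProd _ fun i _ => by fun_prop
      exact this.comp' continuous_subtype_val
    · exact (hc.comp_continuous (continuous_torusMap c _) (torusMap_mem_closedBall c hr)).comp
        continuous_subtype_val⟩
  let e : Fin d → (Fin d → ℂ) → A := fun i z =>
    (⟨fun θ => torusMap c (fun _ => r) θ.1 i, (continuous_torusMap_apply c (fun _ => r) i).comp'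
      continuous_subtype_val⟩ : A) - algebraMap ℂ A (z i)
  have heunit : ∀ i, ∀ z ∈ ball c r, IsUnit (e i z) := by
    intro i z hz
    rw [ContinuousMap.isUnit_iff_forall_ne_zero]
    exact fun θ => torusMap_sub_ne_zero hr hz θ.1 i
  have hean : ∀ i, AnalyticAt ℂ (fun z => Ring.inverse (e i z)) c := by
    intro i
    obtain ⟨u, hu⟩ := heunit i c (mem_ball_self hr)
    have h1 : AnalyticAt ℂ (Ring.inverse : A → A) (e i c) := hu ▸ analyticAt_inverse u
    refine AnalyticAt.comp (g := (Ring.inverse : A → A)) (f := e i) h1 ?_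
    refine analyticAt_const.sub ?_
    exact (((Algebra.linearMap ℂ A).toContinuousLinearMap).comp
      (ContinuousLinearMap.proj (R := ℂ) (φ := fun _ : Fin d => ℂ) i)).analyticAt c
  have hmain : AnalyticAt ℂ
      (fun z => ((2 * Real.pi * I) ^ d)⁻¹ * Λ ((∏ i, Ring.inverse (e i z)) * W)) c := by
    refine analyticAt_const.mul ((Λ.analyticAt _).comp (AnalyticAt.mul ?_ analyticAt_const))
    exact Finset.analyticAt_fun_prod _ fun i _ => hean i
  refine hmain.congr ?_
  filter_upwards [ball_mem_nhds c hr] with z hz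
  have hpi : ((2 * Real.pi * I : ℂ) ^ d) ≠ 0 := by
    apply pow_ne_zero
    simp [Real.pi_ne_zero]
  rw [inv_mul_eq_iff_eq_mul₀ hpi, ← torusIntegral_cauchy f c hr hc hd hz]
  have hinv : ∀ i (θ : S), (Ring.inverse (e i z)) θ
      = (torusMap c (fun _ => r) θ.1 i - z i)⁻¹ := by
    intro i θ
    have h := Ring.mul_inverse_cancel _ (heunit i z hz)
    have h2 := congrArg (fun φ : A => φ θ) h
    exact eq_inv_of_mul_eq_one_right h2
  change ∫ θ : S, ((∏ i, Ring.inverse (e i z)) * W) θ ∂μ = _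
  rw [torusIntegral, ← integral_subtype_comap measurableSet_Icc]
  refine integral_congr_ae (Eventually.of_forall fun θ => ?_)
  have hprod : (∏ i, Ring.inverse (e i z)) θ
      = ∏ i, (torusMap c (fun _ => r) θ.1 i - z i)⁻¹ := by
    rw [ContinuousMap.prod_apply]
    exact Finset.prod_congr rfl fun i _ => hinv i θ
  change (∏ i, Ring.inverse (e i z)) θ *
    ((∏ i : Fin d, (r : ℂ) * exp (θ.1 i * I) * I) * _) = _ • (_ * _)
  rw [hprod, smul_eq_mul, mul_left_comm]

/-- **Osgood's lemma**: a function which is complex differentiable near a point of a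
finite-dimensional space is analytic at that point. -/
lemma analyticAt_of_eventually_differentiableAt {E : Type*} [NormedAddCommGroup E]
    [NormedSpace ℂ E] [FiniteDimensional ℂ E] {f : E → ℂ} {p : E}
    (h : ∀ᶠ x in 𝓝 p, DifferentiableAt ℂ f x) : AnalyticAt ℂ f p := by
  let e : E ≃L[ℂ] (Fin (Module.finrank ℂ E) → ℂ) :=
    ContinuousLinearEquiv.ofFinrankEq (by simp)
  have h' : ∀ᶠ y in 𝓝 (e p), DifferentiableAt ℂ (f ∘ e.symm) y := by
    have ht : Tendsto e.symm (𝓝 (e p)) (𝓝 p) := by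
      simpa using e.symm.continuous.tendsto (e p)
    filter_upwards [ht.eventually h] with y hy
    exact hy.comp y e.symm.differentiableAt
  obtain ⟨r, hr, hball⟩ := Metric.eventually_nhds_iff_ball.1 h'
  have hsub : closedBall (e p) (r / 2) ⊆ ball (e p) r := closedBall_subset_ball (by linarith)
  have : AnalyticAt ℂ (f ∘ e.symm) (e p) := by
    refine analyticAt_of_continuousOn_of_separately _ _ (half_pos hr) ?_ ?_
    · exact fun y hy => (hball y (hsub hy)).continuousAt.continuousWithinAt
    · intro x hx i z hz
      have hmem : Function.update x i z ∈ closedBall (e p) (r / 2) := by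
        rw [mem_closedBall, dist_pi_le_iff (half_pos hr).le] at hx ⊢
        intro j
        by_cases hj : j = i
        · subst hj
          simpa using (mem_ball.1 hz).le
        · simpa [hj] using hx j
      have hu : DifferentiableAt ℂ (fun z => Function.update x i z) z :=
        (hasFDerivAt_update x z).differentiableAt
      exact ((hball _ (hsub hmem)).comp z hu).differentiableWithinAt
  have h3 : AnalyticAt ℂ ((f ∘ e.symm) ∘ e) p :=
    AnalyticAt.comp this (e.analyticAt p)
  refine h3.congr (Eventually.of_forall fun x => ?_)
  simp

lemma analyticAt_integral_of_bound {E α : Type*} [NormedAddCommGroup E]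
    [NormedSpace ℂ E] [FiniteDimensional ℂ E] [MeasurableSpace α] {μ : Measure α}
    {k : E → α → ℂ} {p₀ : E} {r : ℝ} (hr : 0 < r) {B : α → ℝ} (hB : Integrable B μ)
    (hmeas : ∀ p ∈ ball p₀ r, AEStronglyMeasurable (k p) μ)
    (hb : ∀ᵐ a ∂μ, ∀ p ∈ ball p₀ r, ‖k p a‖ ≤ B a)
    (hd : ∀ᵐ a ∂μ, DifferentiableOn ℂ (fun p => k p a) (ball p₀ r)) :
    AnalyticAt ℂ (fun p => ∫ a, k p a ∂μ) p₀ := by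
  have hr2 : 0 < r / 2 := half_pos hr
  apply analyticAt_of_eventually_differentiableAt
  filter_upwards [ball_mem_nhds p₀ hr2] with x hx
  have hsub : ∀ y ∈ ball p₀ (r / 2), ball y (r / 2) ⊆ ball p₀ r := by
    intro y hy z hz
    rw [mem_ball] at *
    linarith [dist_triangle z y p₀]
  have hmem : ∀ y ∈ ball p₀ (r / 2), y ∈ ball p₀ r := fun y hy =>
    ball_subset_ball (by linarith) hy
  refine (hasFDerivAt_integral_of_dominated_of_fderiv_le (𝕜 := ℂ)
    (F' := fun p a => fderiv ℂ (fun p => k p a) p) (bound := fun a => 2 * B a / (r / 2))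
    (isOpen_ball.mem_nhds hx) ?_ ?_ ?_ ?_ ?_ ?_).differentiableAt
  · filter_upwards [isOpen_ball.mem_nhds hx] with y hy using hmeas y (hmem y hy)
  · refine hB.mono' (hmeas x (hmem x hx)) ?_
    filter_upwards [hb] with a ha using ha x (hmem x hx)
  · let b := Module.finBasis ℂ E
    have hdir : ∀ v : E, AEStronglyMeasurable (fun a => fderiv ℂ (fun p => k p a) x v) μ := by
      intro v
      have ht : Tendsto (fun m : ℕ => ((m : ℂ) + 1)⁻¹) atTop (𝓝[≠] 0) := by
        rw [tendsto_nhdsWithin_iff]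
        constructor
        · have := tendsto_one_div_add_atTop_nhds_zero_nat (𝕜 := ℂ)
          simpa using this
        · exact Eventually.of_forall fun m => by
            simpa using Nat.cast_add_one_ne_zero (R := ℂ) m
      have hline : Tendsto (fun m : ℕ => x + ((m : ℂ) + 1)⁻¹ • v) atTop (𝓝 x) := by
        have h1 := ((tendsto_nhdsWithin_iff.1 ht).1.smul_const v).const_add x
        simpa using h1
      obtain ⟨m₀, hm₀⟩ := eventually_atTop.1 (hline.eventually (isOpen_ball.mem_nhds hx))
      refine aestronglyMeasurable_of_tendsto_ae (u := (atTop : Filter ℕ))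
        (f := fun m a => (((m + m₀ : ℕ) : ℂ) + 1) * (k (x + (((m + m₀ : ℕ) : ℂ) + 1)⁻¹ • v) a - k x a))
        (fun m => ?_) ?_
      · exact ((hmeas _ (hmem _ (hm₀ _ (by omega)))).sub (hmeas x (hmem x hx))).const_mul _
      · filter_upwards [hd] with a ha
        have h1 : HasFDerivAt (fun p => k p a) (fderiv ℂ (fun p => k p a) x) x :=
          ((ha x (hmem x hx)).differentiableAt (isOpen_ball.mem_nhds (hmem x hx))).hasFDerivAt
        have h2 := (h1.hasLineDerivAt v).tendsto_slope_zero
        have h3 := (h2.comp ht).comp (tendsto_add_atTop_nat m₀)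
        simpa [Function.comp_def] using h3
    have hsum : (fun a => fderiv ℂ (fun p => k p a) x) = fun a =>
        ∑ i, (fderiv ℂ (fun p => k p a) x (b i)) •
          (LinearMap.toContinuousLinearMap (b.coord i) : E →L[ℂ] ℂ) := by
      ext a v
      have h := congrArg (fderiv ℂ (fun p => k p a) x) (b.sum_repr v)
      rw [map_sum] at h
      rw [← h]
      simp [mul_comm]
    rw [hsum]
    exact Finset.aestronglyMeasurable_fun_sum _ fun i _ => (hdir _).smul_const _
  · filter_upwards [hb, hd] with a ha hda y hy
    refine norm_fderiv_le_div_of_mapsTo_ball (hda.mono (hsub y hy)) ?_ hr2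
    intro z hz
    rw [mem_closedBall, dist_eq_norm]
    have h1 := ha z (hsub y hy hz)
    have h2 := ha y (hmem y hy)
    linarith [norm_sub_le (k z a) (k y a)]
  · exact (hB.const_mul 2).div_const _
  · filter_upwards [hd] with a ha y hy
    exact ((ha y (hmem y hy)).differentiableAt (isOpen_ball.mem_nhds (hmem y hy))).hasFDerivAt

/-- The analytic continuation in `β` of `Γ(β)⁻¹ ∫₀¹ u^(β-1) g(u) du`, valid for `Re β > -M`,
obtained by `M` integrations by parts. -/
def regMellin : ℕ → ℂ → (ℂ → ℂ) → ℂ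
  | 0, β, g => (Complex.Gamma β)⁻¹ * ∫ u in Ioo (0 : ℝ) 1, (u : ℂ) ^ (β - 1) * g u
  | M + 1, β, g => (Complex.Gamma (β + 1))⁻¹ * g 1 - regMellin M (β + 1) (deriv g)

lemma integrableOn_cpow_mul {β : ℂ} (hβ : 0 < β.re) {g : ℝ → ℂ} (hg : ContinuousOn g (Icc 0 1)) :
    IntegrableOn (fun u : ℝ => (u : ℂ) ^ (β - 1) * g u) (Ioo 0 1) := by
  have h1 : IntervalIntegrable (fun u : ℝ => (u : ℂ) ^ (β - 1)) volume 0 1 :=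
    intervalIntegral.intervalIntegrable_cpow' (by simpa using hβ)
  have h2 := h1.mul_continuousOn (g := g) (by simpa using hg)
  exact ((intervalIntegrable_iff_integrableOn_Ioc_of_le zero_le_one).1 h2).mono_set
    Ioo_subset_Ioc_self

lemma regMellin_one_eq_zero {β : ℂ} (hβ : 0 < β.re) {g : ℂ → ℂ}
    (hg : ∀ u : ℝ, u ∈ Icc (0 : ℝ) 1 → AnalyticAt ℂ g u) :
    regMellin 1 β g = regMellin 0 β g := by
  have hβ0 : β ≠ 0 := by rintro rfl; simp at hβ
  have hgc : ContinuousOn (fun u : ℝ => g u) (Icc 0 1) := fun u hu =>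
    ((hg u hu).continuousAt.comp continuous_ofReal.continuousAt).continuousWithinAt
  have hgc' : ContinuousOn (fun u : ℝ => deriv g u) (Icc 0 1) := fun u hu =>
    ((hg u hu).deriv.continuousAt.comp continuous_ofReal.continuousAt).continuousWithinAt
  have hi1 := integrableOn_cpow_mul hβ hgc
  have hi2 := integrableOn_cpow_mul (β := β + 1) (by simp; linarith) hgc'
  have hpow : ContinuousOn (fun u : ℝ => (u : ℂ) ^ β) (Icc 0 1) := fun u _ =>
    (continuousAt_ofReal_cpow_const u β (Or.inl hβ)).continuousWithinAt
  have key : ∫ u in (0 : ℝ)..1, (β * ((u : ℂ) ^ (β - 1) * g u) + (u : ℂ) ^ (β + 1 - 1) * deriv g u)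
      = (1 : ℂ) ^ β * g 1 - (0 : ℂ) ^ β * g 0 := by
    have := intervalIntegral.integral_eq_sub_of_hasDerivAt_of_le (a := 0) (b := 1)
      (f := fun u : ℝ => (u : ℂ) ^ β * g u)
      (f' := fun u : ℝ => β * ((u : ℂ) ^ (β - 1) * g u) + (u : ℂ) ^ (β + 1 - 1) * deriv g u)
      zero_le_one (hpow.mul hgc) ?_ ?_
    · simpa using this
    · intro u hu
      have h1 : HasDerivAt (fun u : ℝ => (u : ℂ) ^ β) (β * (u : ℂ) ^ (β - 1)) u := by
        have := hasDerivAt_ofReal_cpow_const' (x := u) hu.1.ne' (r := β - 1) (by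
          intro h
          apply hβ0
          linear_combination h)
        have h3 := this.const_mul β
        simp only [sub_add_cancel] at h3
        refine h3.congr_of_eventuallyEq (Eventually.of_forall fun v => ?_)
        field_simp
      have h2 : HasDerivAt (fun u : ℝ => g u) (deriv g u) u :=
        ((hg u (Ioo_subset_Icc_self hu)).differentiableAt.hasDerivAt).comp_ofReal
      have h3 := h1.mul h2
      simp only [add_sub_cancel_right]
      rw [← mul_assoc]
      exact h3
    · rw [intervalIntegrable_iff_integrableOn_Ioo_of_le zero_le_one]
      exact (hi1.const_mul β).add hi2
  rw [intervalIntegral.integral_of_le zero_le_one, integral_Ioc_eq_integral_Ioo,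
    integral_add (hi1.const_mul β) hi2, integral_const_mul, one_cpow, zero_cpow hβ0] at key
  have hG : Complex.Gamma (β + 1) = β * Complex.Gamma β := Complex.Gamma_add_one β hβ0
  have hG0 : Complex.Gamma β ≠ 0 := Complex.Gamma_ne_zero_of_re_pos hβ
  simp only [regMellin]
  rw [hG]
  field_simp
  linear_combination -key

lemma regMellin_succ_eq (M : ℕ) : ∀ {β : ℂ} (_ : -(M : ℝ) < β.re) {g : ℂ → ℂ}
    (_ : ∀ u : ℝ, u ∈ Icc (0 : ℝ) 1 → AnalyticAt ℂ g u),
    regMellin (M + 1) β g = regMellin M β g := by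
  induction M with
  | zero => exact fun hβ _ hg => regMellin_one_eq_zero (by simpa using hβ) hg
  | succ M ih =>
    intro β hβ g hg
    rw [regMellin, ih (by push_cast at hβ; simp; linarith) fun u hu => (hg u hu).deriv]
    rfl

lemma regMellin_eq_of_le {M M' : ℕ} (h : M ≤ M') {β : ℂ} (hβ : -(M : ℝ) < β.re) {g : ℂ → ℂ}
    (hg : ∀ u : ℝ, u ∈ Icc (0 : ℝ) 1 → AnalyticAt ℂ g u) :
    regMellin M' β g = regMellin M β g := by
  induction M', h using Nat.le_induction with
  | base => rfl
  | succ k hk ih =>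
    rw [regMellin_succ_eq k _ hg, ih]
    have : (M : ℝ) ≤ k := by exact_mod_cast hk
    linarith

section
variable {E : Type*} [NormedAddCommGroup E] [NormedSpace ℂ E] [FiniteDimensional ℂ E]

omit [NormedSpace ℂ E] [FiniteDimensional ℂ E] in
lemma eventually_forall_Icc {P : E × ℂ → Prop} {p₀ : E}
    (h : ∀ u : ℝ, u ∈ Icc (0 : ℝ) 1 → ∀ᶠ q in 𝓝 ((p₀, (u : ℂ)) : E × ℂ), P q) :
    ∀ᶠ p in 𝓝 p₀, ∀ u : ℝ, u ∈ Icc (0 : ℝ) 1 → P (p, u) := by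
  refine isCompact_Icc.eventually_forall_of_forall_eventually fun u hu => ?_
  have : Continuous fun z : E × ℝ => ((z.1, (z.2 : ℂ)) : E × ℂ) := by fun_prop
  exact (this.tendsto (p₀, u)).eventually (h u hu)

lemma analyticAt_mellin_Ioo {β : E → ℂ} {g : E × ℂ → ℂ} {p₀ : E} (hβ : AnalyticAt ℂ β p₀)
    (hβ0 : 0 < (β p₀).re) (hg : ∀ u : ℝ, u ∈ Icc (0 : ℝ) 1 → AnalyticAt ℂ g (p₀, u)) :
    AnalyticAt ℂ (fun p => ∫ u in Ioo (0 : ℝ) 1, (u : ℂ) ^ (β p - 1) * g (p, u)) p₀ := by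
  set δ := (β p₀).re / 2 with hδ
  have hδ0 : 0 < δ := half_pos hβ0
  obtain ⟨C, hC⟩ : ∃ C, ∀ u : ℝ, u ∈ Icc (0 : ℝ) 1 → ‖g (p₀, u)‖ ≤ C := by
    apply isCompact_Icc.exists_bound_of_continuousOn (f := fun u : ℝ => g (p₀, u))
    intro u hu
    have h1 : ContinuousAt (fun u : ℝ => ((p₀, (u : ℂ)) : E × ℂ)) u := by fun_prop
    exact (ContinuousAt.comp (g := g) (f := fun u : ℝ => (p₀, (u : ℂ))) (hg u hu).continuousAt
      h1).continuousWithinAt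
  have e1 : ∀ᶠ p in 𝓝 p₀, ∀ u : ℝ, u ∈ Icc (0 : ℝ) 1 →
      AnalyticAt ℂ g (p, u) ∧ ‖g (p, u)‖ < C + 1 := by
    refine eventually_forall_Icc (P := fun q => AnalyticAt ℂ g q ∧ ‖g q‖ < C + 1) fun u hu => ?_
    refine (hg u hu).eventually_analyticAt.and ?_
    exact (hg u hu).continuousAt.norm.eventually_lt continuousAt_const
      (by linarith [hC u hu])
  have e2 : ∀ᶠ p in 𝓝 p₀, δ < (β p).re :=
    continuousAt_const.eventually_lt (continuous_re.continuousAt.comp hβ.continuousAt)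
      (by linarith)
  obtain ⟨r, hr, hball⟩ := Metric.eventually_nhds_iff_ball.1
    ((e1.and e2).and hβ.eventually_analyticAt)
  refine analyticAt_integral_of_bound (B := fun u => u ^ (δ - 1) * (C + 1)) hr ?_ ?_ ?_ ?_
  · have h1 : IntervalIntegrable (fun u : ℝ => u ^ (δ - 1)) volume 0 1 :=
      intervalIntegral.intervalIntegrable_rpow' (by linarith)
    exact ((intervalIntegrable_iff_integrableOn_Ioo_of_le zero_le_one).1 h1).mul_const _
  · intro p hp
    have ⟨⟨h1, h2⟩, _⟩ := hball p hp
    refine (integrableOn_cpow_mul (hδ0.trans h2) (g := fun u => g (p, u)) ?_).aestronglyMeasurable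
    intro u hu
    have h3 : ContinuousAt (fun u : ℝ => ((p, (u : ℂ)) : E × ℂ)) u := by fun_prop
    exact (ContinuousAt.comp (g := g) (f := fun u : ℝ => (p, (u : ℂ))) (h1 u hu).1.continuousAt
      h3).continuousWithinAt
  · filter_upwards [ae_restrict_mem measurableSet_Ioo] with u hu p hp
    have ⟨⟨h1, h2⟩, _⟩ := hball p hp
    rw [norm_mul, norm_cpow_eq_rpow_re_of_pos hu.1]
    have h3 := (h1 u (Ioo_subset_Icc_self hu)).2.le
    refine mul_le_mul ?_ h3 (norm_nonneg _) (Real.rpow_nonneg hu.1.le _)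
    exact Real.rpow_le_rpow_of_exponent_ge hu.1 hu.2.le (by simp; linarith)
  · filter_upwards [ae_restrict_mem measurableSet_Ioo] with u hu p hp
    have ⟨⟨h1, h2⟩, h3⟩ := hball p hp
    refine (DifferentiableAt.mul ?_ ?_).differentiableWithinAt
    · exact (h3.differentiableAt.sub_const 1).const_cpow (Or.inl (by exact_mod_cast hu.1.ne'))
    · have h4 := (h1 u (Ioo_subset_Icc_self hu)).1.differentiableAt
      exact DifferentiableAt.comp (g := g) (f := fun p => (p, (u : ℂ))) p h4 (by fun_prop)

omit [FiniteDimensional ℂ E] in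
lemma AnalyticAt.deriv_snd {g : E × ℂ → ℂ} {q : E × ℂ} (hg : AnalyticAt ℂ g q) :
    AnalyticAt ℂ (fun q : E × ℂ => deriv (fun v => g (q.1, v)) q.2) q := by
  have h1 : AnalyticAt ℂ (fun q => fderiv ℂ g q (0, 1)) q :=
    ((ContinuousLinearMap.apply ℂ ℂ ((0, 1) : E × ℂ)).analyticAt _).comp hg.fderiv
  refine h1.congr ?_
  filter_upwards [hg.eventually_analyticAt] with x hx
  have h2 : HasFDerivAt g (fderiv ℂ g x) (x.1, x.2) := hx.differentiableAt.hasFDerivAt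
  have h3 : HasDerivAt (fun v : ℂ => ((x.1, v) : E × ℂ)) (0, 1) x.2 :=
    (hasDerivAt_const _ _).prodMk (hasDerivAt_id _)
  exact (h2.comp_hasDerivAt x.2 h3).deriv.symm

lemma analyticAt_regMellin (M : ℕ) : ∀ {β : E → ℂ} {g : E × ℂ → ℂ} {p₀ : E}
    (_ : AnalyticAt ℂ β p₀) (_ : -(M : ℝ) < (β p₀).re)
    (_ : ∀ u : ℝ, u ∈ Icc (0 : ℝ) 1 → AnalyticAt ℂ g (p₀, u)),
    AnalyticAt ℂ (fun p => regMellin M (β p) (fun u => g (p, u))) p₀ := by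
  have hGamma : Differentiable ℂ fun s : ℂ => (Complex.Gamma s)⁻¹ :=
    Complex.differentiable_one_div_Gamma
  induction M with
  | zero =>
    intro β g p₀ hβ hβ0 hg
    simp only [regMellin]
    refine AnalyticAt.mul ?_ (analyticAt_mellin_Ioo hβ (by simpa using hβ0) hg)
    exact (hGamma.analyticAt _).comp hβ
  | succ M ih =>
    intro β g p₀ hβ hβ0 hg
    simp only [regMellin]
    refine AnalyticAt.sub (AnalyticAt.mul ?_ ?_) ?_
    · exact AnalyticAt.comp (g := fun s : ℂ => (Complex.Gamma s)⁻¹) (hGamma.analyticAt _)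
        (hβ.add analyticAt_const)
    · have h1 := hg 1 (by simp)
      exact AnalyticAt.comp (g := g) (f := fun p : E => (p, (1 : ℂ))) (by simpa using h1)
        (analyticAt_id.prod analyticAt_const)
    · refine ih (β := fun p => β p + 1)
        (g := fun q : E × ℂ => deriv (fun v => g (q.1, v)) q.2)
        (hβ.add analyticAt_const) ?_ fun u hu => (hg u hu).deriv_snd
      push_cast at hβ0
      simp
      linarith

/-- Division of `∫₀¹ u^(β-1) g(u) du` by `Γ(β)` gives a function which continues analytically
in all parameters, without any condition on `β`. -/
lemma exists_analytic_mellin (β : E → ℂ) (hβ : ∀ p, AnalyticAt ℂ β p) (g : E × ℂ → ℂ) :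
    ∃ h : E → ℂ, ∀ p, (∀ u : ℝ, u ∈ Icc (0 : ℝ) 1 → AnalyticAt ℂ g (p, u)) →
      AnalyticAt ℂ h p ∧ (0 < (β p).re →
        ∫ u in Ioo (0 : ℝ) 1, (u : ℂ) ^ (β p - 1) * g (p, u) = Complex.Gamma (β p) * h p) := by
  have hsec : ∀ p, (∀ u : ℝ, u ∈ Icc (0 : ℝ) 1 → AnalyticAt ℂ g (p, u)) →
      ∀ u : ℝ, u ∈ Icc (0 : ℝ) 1 → AnalyticAt ℂ (fun v => g (p, v)) u := fun p hp u hu =>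
    AnalyticAt.comp (g := g) (f := fun v : ℂ => (p, v)) (hp u hu)
      (analyticAt_const.prod analyticAt_id)
  have hfl : ∀ x : ℝ, -((⌊-x⌋₊ + 1 : ℕ) : ℝ) < x := fun x => by
    have := Nat.lt_floor_add_one (-x)
    push_cast
    linarith
  have key : ∀ p, (∀ u : ℝ, u ∈ Icc (0 : ℝ) 1 → AnalyticAt ℂ g (p, u)) → ∀ M : ℕ,
      -(M : ℝ) < (β p).re → regMellin (⌊-(β p).re⌋₊ + 1) (β p) (fun u => g (p, u))
        = regMellin M (β p) (fun u => g (p, u)) := by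
    intro p hp M hM
    rcases le_total M (⌊-(β p).re⌋₊ + 1) with h | h
    · exact regMellin_eq_of_le h hM (hsec p hp)
    · exact (regMellin_eq_of_le h (hfl _) (hsec p hp)).symm
  refine ⟨fun p => regMellin (⌊-(β p).re⌋₊ + 1) (β p) (fun u => g (p, u)), fun p hp => ⟨?_, ?_⟩⟩
  · refine (analyticAt_regMellin (⌊-(β p).re⌋₊ + 1) (hβ p) (hfl _) hp).congr ?_
    have e1 := eventually_forall_Icc (P := fun q => AnalyticAt ℂ g q) (p₀ := p)
      fun u hu => (hp u hu).eventually_analyticAt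
    have e2 : ∀ᶠ q in 𝓝 p, -((⌊-(β p).re⌋₊ + 1 : ℕ) : ℝ) < (β q).re :=
      continuousAt_const.eventually_lt (continuous_re.continuousAt.comp (hβ p).continuousAt)
        (hfl _)
    filter_upwards [e1, e2] with q h1 h2
    exact (key q h1 _ h2).symm
  · intro h0
    dsimp only
    rw [key p hp 0 (by simpa using h0), regMellin,
      mul_inv_cancel_left₀ (Complex.Gamma_ne_zero_of_re_pos h0)]

end

/-- The open unit cube. -/
def cube (m : ℕ) : Set (Fin m → ℝ) := univ.pi fun _ => Ioo (0 : ℝ) 1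

lemma measurableSet_cube (m : ℕ) : MeasurableSet (cube m) :=
  MeasurableSet.univ_pi fun _ => measurableSet_Ioo

/-- The part of `A^(m+1)` on which the `j`-th coordinate strictly dominates the others. -/
def sector {m : ℕ} (A : Set ℝ) (j : Fin (m + 1)) : Set (Fin (m + 1) → ℝ) :=
  {x | x j ∈ A ∧ ∀ k, x (j.succAbove k) ∈ Ioo 0 (x j)}

lemma measurableSet_sector {m : ℕ} {A : Set ℝ} (hA : MeasurableSet A) (j : Fin (m + 1)) :
    MeasurableSet (sector A j) := by
  refine (measurable_pi_apply j hA).inter ?_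
  have : {x : Fin (m + 1) → ℝ | ∀ k, x (j.succAbove k) ∈ Ioo 0 (x j)} =
      ⋂ k, ({x | 0 < x (j.succAbove k)} ∩ {x | x (j.succAbove k) < x j}) := by
    ext x; simp
  change MeasurableSet {x : Fin (m + 1) → ℝ | ∀ k, x (j.succAbove k) ∈ Ioo 0 (x j)}
  rw [this]
  exact MeasurableSet.iInter fun k =>
    (measurableSet_lt measurable_const (measurable_pi_apply _)).inter
      (measurableSet_lt (measurable_pi_apply _) (measurable_pi_apply _))

lemma smul_cube {m : ℕ} {u : ℝ} (hu : 0 < u) :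
    u • cube m = univ.pi fun _ => Ioo 0 u := by
  ext y
  rw [mem_smul_set_iff_inv_smul_mem₀ hu.ne']
  simp only [cube, mem_univ_pi, Pi.smul_apply, smul_eq_mul, mem_Ioo]
  refine forall_congr' fun i => ?_
  rw [inv_mul_lt_iff₀ hu, mul_one, mul_pos_iff_of_pos_left (inv_pos.2 hu)]

section
variable {m : ℕ} {A : Set ℝ} (hA : MeasurableSet A) (hA0 : A ⊆ Ioi 0) (j : Fin (m + 1))
  {F : Type*} [NormedAddCommGroup F] [NormedSpace ℝ F]
  {f : (Fin (m + 1) → ℝ) → F}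

omit [NormedSpace ℝ F] in
lemma sector_preimage (x : ℝ × (Fin m → ℝ)) :
    (fun x : ℝ × (Fin m → ℝ) => (sector A j).indicator f (j.insertNth x.1 x.2)) x =
      A.indicator (fun u => (univ.pi fun _ => Ioo 0 u).indicator
        (fun y => f (j.insertNth u y)) x.2) x.1 := by
  obtain ⟨u, y⟩ := x
  simp only [sector, indicator, mem_ofPred_eq, Fin.insertNth_apply_same,
    Fin.insertNth_apply_succAbove, mem_univ_pi]
  by_cases h : u ∈ A <;> simp [h]

omit [NormedSpace ℝ F] in
include hA in
lemma integrable_sector_prod (hf : IntegrableOn f (sector A j)) :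
    Integrable (fun x : ℝ × (Fin m → ℝ) => A.indicator (fun u => (univ.pi fun _ => Ioo 0 u).indicator
        (fun y => f (j.insertNth u y)) x.2) x.1) (volume.prod volume) := by
  have h1 := (integrable_indicator_iff (measurableSet_sector hA j)).2 hf
  have h2 := ((volume_preserving_piFinSuccAbove (fun _ : Fin (m + 1) => ℝ) j).symm
    _).integrable_comp_of_integrable h1
  refine h2.congr (Eventually.of_forall fun x => ?_)
  exact sector_preimage j x

include hA in
lemma integral_sector_prod [CompleteSpace F] :
    ∫ x in sector A j, f x =
    ∫ x : ℝ × (Fin m → ℝ), A.indicator (fun u => (univ.pi fun _ => Ioo 0 u).indicator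
        (fun y => f (j.insertNth u y)) x.2) x.1 ∂(volume.prod volume) := by
  rw [← integral_indicator (measurableSet_sector hA j)]
  have h := ((volume_preserving_piFinSuccAbove (fun _ : Fin (m + 1) => ℝ) j).symm _).integral_comp'
    ((sector A j).indicator f)
  rw [← h]
  refine integral_congr_ae (Eventually.of_forall fun x => ?_)
  exact sector_preimage j x

lemma integral_box_eq {u : ℝ} (hu : 0 < u) (g : (Fin m → ℝ) → F) :
    ∫ y in univ.pi fun _ => Ioo 0 u, g y = u ^ m • ∫ y in cube m, g (u • y) := by
  rw [Measure.setIntegral_comp_smul_of_pos _ _ _ hu, smul_cube hu, smul_smul]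
  simp [mul_inv_cancel₀ (pow_pos hu m).ne']

omit [NormedSpace ℝ F] in
lemma integrableOn_box_iff {u : ℝ} (hu : 0 < u) (g : (Fin m → ℝ) → F) :
    IntegrableOn g (univ.pi fun _ => Ioo 0 u) ↔ IntegrableOn (fun y => g (u • y)) (cube m) := by
  rw [← integrable_indicator_iff (measurableSet_cube m), ← integrable_indicator_iff
    (MeasurableSet.univ_pi fun _ => measurableSet_Ioo),
    ← integrable_comp_smul_iff volume _ hu.ne']
  refine iff_of_eq (congrArg (Integrable · volume) ?_)
  ext y
  have : u • y ∈ (univ.pi fun _ : Fin m => Ioo 0 u) ↔ y ∈ cube m := by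
    rw [← smul_cube hu, smul_mem_smul_set_iff₀ hu.ne']
  by_cases h : y ∈ cube m
  · rw [indicator_of_mem h, indicator_of_mem (this.2 h)]
  · rw [indicator_of_notMem h, indicator_of_notMem (mt this.1 h)]

omit [NormedSpace ℝ F] in
include hA hA0 in
lemma ae_integrableOn_section (hf : IntegrableOn f (sector A j)) :
    ∀ᵐ u ∂volume.restrict A, IntegrableOn (fun y => f (j.insertNth u (u • y))) (cube m) := by
  rw [ae_restrict_iff' hA]
  filter_upwards [(integrable_sector_prod hA j hf).prod_right_ae] with u hu huA
  simp only [indicator_of_mem huA] at hu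
  rw [integrable_indicator_iff (MeasurableSet.univ_pi fun _ => measurableSet_Ioo)] at hu
  exact (integrableOn_box_iff (hA0 huA) _).1 hu

include hA hA0 in
lemma integral_sector [CompleteSpace F] (hf : IntegrableOn f (sector A j)) :
    ∫ x in sector A j, f x =
      ∫ u in A, u ^ m • ∫ y in cube m, f (j.insertNth u (u • y)) := by
  rw [integral_sector_prod hA, integral_prod _ (integrable_sector_prod hA j hf),
    ← integral_indicator hA]
  refine integral_congr_ae (Eventually.of_forall fun u => ?_)
  by_cases hu : u ∈ A
  · simp only [indicator_of_mem hu]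
    rw [integral_indicator (MeasurableSet.univ_pi fun _ => measurableSet_Ioo),
      integral_box_eq (hA0 hu)]
  · simp [indicator_of_notMem hu]

omit [NormedSpace ℝ F] in
include hA hA0 in
lemma integrableOn_section_norm (hf : IntegrableOn f (sector A j)) :
    IntegrableOn (fun u => u ^ m * ∫ y in cube m, ‖f (j.insertNth u (u • y))‖) A := by
  have h := (integrable_sector_prod hA j hf).integral_norm_prod_left
  rw [← integrable_indicator_iff hA]
  refine h.congr (Eventually.of_forall fun u => ?_)
  by_cases hu : u ∈ A
  · simp only [indicator_of_mem hu, norm_indicator_eq_indicator_norm]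
    rw [integral_indicator (MeasurableSet.univ_pi fun _ => measurableSet_Ioo),
      integral_box_eq (hA0 hu), smul_eq_mul]
  · simp [indicator_of_notMem hu]

lemma sector_subset_pi (hA1 : ∀ u ∈ A, ∀ v, 0 < v → v < u → v ∈ A) :
    sector A j ⊆ univ.pi fun _ => A := by
  intro x hx i _
  rcases Fin.eq_self_or_eq_succAbove j i with rfl | ⟨k, rfl⟩
  · exact hx.1
  · exact hA1 _ hx.1 _ (hx.2 k).1 (hx.2 k).2

lemma ae_forall_ne : ∀ᵐ x : Fin (m + 1) → ℝ, ∀ i k, i ≠ k → x i ≠ x k := by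
  rw [ae_all_iff]; intro i
  rw [ae_all_iff]; intro k
  by_cases hik : i = k
  · exact Eventually.of_forall fun x h => absurd hik h
  simp only [ne_eq, hik, not_false_eq_true, forall_const]
  have := Measure.addHaar_submodule (volume : Measure (Fin (m + 1) → ℝ))
    (LinearMap.ker (LinearMap.proj (R := ℝ) (φ := fun _ : Fin (m+1) => ℝ) i - LinearMap.proj k)) ?_
  · rw [ae_iff]
    convert this using 2
    ext x
    simp [sub_eq_zero]
  · intro h
    have h2 : (Pi.single i (1 : ℝ)) ∈ LinearMap.ker (LinearMap.proj (R := ℝ)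
        (φ := fun _ : Fin (m + 1) => ℝ) i - LinearMap.proj k) := h ▸ Submodule.mem_top
    simp [Ne.symm hik] at h2

include hA hA0 in
/-- Integration over `A^(m+1)` by splitting according to the largest coordinate. -/
lemma integral_pi_eq_sum_sector [CompleteSpace F]
    (hA1 : ∀ u ∈ A, ∀ v, 0 < v → v < u → v ∈ A)
    (hf : IntegrableOn f (univ.pi fun _ => A)) :
    ∫ x in univ.pi fun _ => A, f x =
      ∑ j : Fin (m + 1), ∫ u in A, u ^ m • ∫ y in cube m, f (j.insertNth u (u • y)) := by
  have hs : (univ.pi fun _ => A : Set (Fin (m + 1) → ℝ)) =ᵐ[volume]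
      ⋃ j ∈ (Finset.univ : Finset (Fin (m + 1))), sector A j := by
    filter_upwards [ae_forall_ne (m := m)] with x hx
    refine propext ⟨fun h => ?_, fun h => ?_⟩
    · obtain ⟨j, hj⟩ := Finite.exists_max x
      refine mem_iUnion₂.2 ⟨j, Finset.mem_univ _, h j trivial, fun k => ⟨hA0 (h _ trivial), ?_⟩⟩
      exact lt_of_le_of_ne (hj _) (hx _ _ (Fin.succAbove_ne j k))
    · obtain ⟨j, _, hj⟩ := mem_iUnion₂.1 h
      exact sector_subset_pi j hA1 hj
  rw [setIntegral_congr_set hs, integral_biUnion_finset _ fun j _ => measurableSet_sector hA j]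
  · exact Finset.sum_congr rfl fun j _ =>
      integral_sector hA hA0 j (hf.mono_set (sector_subset_pi j hA1))
  · intro i _ j _ hij
    refine disjoint_left.2 fun x hi hj => ?_
    obtain ⟨k, hk⟩ := Fin.exists_succAbove_eq hij
    obtain ⟨l, hl⟩ := Fin.exists_succAbove_eq hij.symm
    have h1 := (hj.2 k).2
    have h2 := (hi.2 l).2
    rw [hk] at h1
    rw [hl] at h2
    exact lt_asymm h1 h2
  · exact fun j _ => hf.mono_set (sector_subset_pi j hA1)
end

/-- The linear form with coefficients `b`. -/
def linForm {m : ℕ} (b x : Fin m → ℂ) : ℂ := ∑ j, x j * b j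

/-- Coordinatewise coercion of a real vector. -/
def vecCast {m : ℕ} (x : Fin m → ℝ) : Fin m → ℂ := fun i => x i

/-- Products of powers of the coordinates, inverse linear forms and an analytic factor. -/
def cubeIntegrand {E : Type} {N m : ℕ} (σ : E → ℂ) (b : Fin N → Fin m → ℂ) (R : Finset (Fin N))
    (G : E × (Fin m → ℂ) → ℂ) (p : E) (x : Fin m → ℝ) : ℂ :=
  (∏ j, (x j : ℂ) ^ (σ p - 1)) * (∏ i ∈ R, (linForm (b i) (vecCast x))⁻¹) * G (p, vecCast x)

/-- The product of Gamma factors carrying the poles of the integral over the cube. -/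
def gammaProd (q N m : ℕ) (s : ℂ) : ℂ :=
  ∏ k ∈ Finset.range m, if q ≤ k + 1 then Complex.Gamma (((k : ℂ) + 1) * s - N) else Complex.Gamma s

lemma re_linForm_nonneg {m : ℕ} {b : Fin m → ℂ} (hb : ∀ j, b j = 0 ∨ 0 < (b j).re)
    {x : Fin m → ℝ} (hx : ∀ j, 0 ≤ x j) : 0 ≤ (linForm b (vecCast x)).re := by
  simp only [linForm, vecCast, re_sum, re_ofReal_mul]
  refine Finset.sum_nonneg fun j _ => mul_nonneg (hx j) ?_
  rcases hb j with h | h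
  · simp [h]
  · exact h.le

lemma vecCast_insertNth {m : ℕ} (j : Fin (m + 1)) (u : ℝ) (y : Fin m → ℝ) :
    vecCast (j.insertNth u (u • y) : Fin (m + 1) → ℝ) =
      (j.insertNth (u : ℂ) ((u : ℂ) • vecCast y) : Fin (m + 1) → ℂ) := by
  ext i
  revert i
  rw [Fin.forall_iff_succAbove j]
  simp [vecCast]

lemma vecCast_insertNth' {m : ℕ} (j : Fin (m + 1)) (u : ℝ) (y : Fin m → ℝ) :
    vecCast (j.insertNth u y : Fin (m + 1) → ℝ) =
      (j.insertNth (u : ℂ) (vecCast y) : Fin (m + 1) → ℂ) := by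
  ext i
  revert i
  rw [Fin.forall_iff_succAbove j]
  simp [vecCast]

lemma linForm_insertNth {m : ℕ} (j : Fin (m + 1)) (b : Fin (m + 1) → ℂ) (u : ℂ) (y : Fin m → ℂ) :
    linForm b (j.insertNth u (u • y)) = u * (b j + linForm (b ∘ j.succAbove) y) := by
  simp only [linForm, Fin.sum_univ_succAbove _ j, Fin.insertNth_apply_same,
    Fin.insertNth_apply_succAbove, Pi.smul_apply, smul_eq_mul, Function.comp, mul_add,
    Finset.mul_sum]
  congr 1
  exact Finset.sum_congr rfl fun k _ => by ring

/-- The analytic factor obtained after substituting `x = u • (1, y)` in the `j`-th sector. -/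
def sectorFactor {E : Type} {N m : ℕ} (b : Fin N → Fin (m + 1) → ℂ) (R : Finset (Fin N))
    (G : E × (Fin (m + 1) → ℂ) → ℂ) (j : Fin (m + 1)) (z : (E × ℂ) × (Fin m → ℂ)) : ℂ :=
  G (z.1.1, j.insertNth z.1.2 (z.1.2 • z.2)) *
    (∏ i ∈ R.filter (fun i => b i j ≠ 0), (b i j + linForm (b i ∘ j.succAbove) z.2)⁻¹) *
    z.1.2 ^ (N - R.card)

lemma prod_insertNth_cpow {m : ℕ} (j : Fin (m + 1)) {u : ℝ} (hu : 0 < u) {y : Fin m → ℝ}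
    (hy : ∀ k, 0 < y k) (s : ℂ) :
    ∏ i, (((j.insertNth u (u • y) : Fin (m + 1) → ℝ) i : ℝ) : ℂ) ^ s =
      (u : ℂ) ^ (((m : ℂ) + 1) * s) * ∏ k, (y k : ℂ) ^ s := by
  have hu' : (u : ℂ) ≠ 0 := ofReal_ne_zero.2 hu.ne'
  rw [Fin.prod_univ_succAbove _ j]
  simp only [Fin.insertNth_apply_same, Fin.insertNth_apply_succAbove, Pi.smul_apply, smul_eq_mul,
    ofReal_mul]
  simp_rw [fun k => mul_cpow_ofReal_nonneg hu.le (hy k).le s]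
  rw [Finset.prod_mul_distrib, Finset.prod_const, Finset.card_univ, Fintype.card_fin, add_mul,
    cpow_add _ _ hu', one_mul, ← cpow_nat_mul]
  ring

lemma cubeIntegrand_insertNth {E : Type} {N m : ℕ} (σ : E → ℂ) (b : Fin N → Fin (m + 1) → ℂ)
    (R : Finset (Fin N)) (G : E × (Fin (m + 1) → ℂ) → ℂ) (j : Fin (m + 1)) (p : E) {u : ℝ}
    (hu : 0 < u) {y : Fin m → ℝ} (hy : y ∈ cube m) :
    (u : ℂ) ^ m * cubeIntegrand σ b R G p (j.insertNth u (u • y)) =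
      (u : ℂ) ^ ((((m : ℂ) + 1) * σ p - N) - 1) *
        cubeIntegrand (fun z : E × ℂ => σ z.1) (fun i => b i ∘ j.succAbove)
          (R.filter (fun i => b i j = 0)) (sectorFactor b R G j) (p, (u : ℂ)) y := by
  have hu' : (u : ℂ) ≠ 0 := ofReal_ne_zero.2 hu.ne'
  have hcard : R.card ≤ N := by simpa using Finset.card_le_univ R
  have h1 : (∏ i ∈ R, (linForm (b i) (vecCast (j.insertNth u (u • y))))⁻¹) =
      ((u : ℂ) ^ R.card)⁻¹ * ((∏ i ∈ R.filter (fun i => b i j = 0),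
        (linForm (b i ∘ j.succAbove) (vecCast y))⁻¹) *
        ∏ i ∈ R.filter (fun i => b i j ≠ 0), (b i j + linForm (b i ∘ j.succAbove) (vecCast y))⁻¹) := by
    simp_rw [vecCast_insertNth, linForm_insertNth, mul_inv]
    rw [Finset.prod_mul_distrib, Finset.prod_const, inv_pow,
      ← Finset.prod_filter_mul_prod_filter_not R (fun i => b i j = 0)]
    congr 2
    refine Finset.prod_congr rfl fun i hi => ?_
    rw [(Finset.mem_filter.1 hi).2, zero_add]
  have h2 : (u : ℂ) ^ m * (u : ℂ) ^ (((m : ℂ) + 1) * (σ p - 1)) * ((u : ℂ) ^ R.card)⁻¹ =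
      (u : ℂ) ^ ((((m : ℂ) + 1) * σ p - N) - 1) * (u : ℂ) ^ (N - R.card) := by
    have h3 : (u : ℂ) ^ N = (u : ℂ) ^ (N - R.card) * (u : ℂ) ^ R.card := by
      rw [← pow_add, Nat.sub_add_cancel hcard]
    have h4 : (u : ℂ) ^ (((m : ℂ) + 1) * (σ p - 1)) * (u : ℂ) ^ m * (u : ℂ) =
        (u : ℂ) ^ (((m : ℂ) + 1) * σ p) := by
      rw [← cpow_natCast _ m, mul_assoc]
      nth_rw 3 [← cpow_one (u : ℂ)]
      rw [← cpow_add _ _ hu', ← cpow_add _ _ hu']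
      congr 1; ring
    rw [cpow_sub _ _ hu', cpow_sub _ _ hu', cpow_natCast, cpow_one, ← h4, h3]
    field_simp
  simp only [cubeIntegrand, sectorFactor]
  rw [prod_insertNth_cpow j hu (fun k => (hy k trivial).1), h1, vecCast_insertNth]
  linear_combination (∏ k, (y k : ℂ) ^ (σ p - 1)) * ((∏ i ∈ R.filter (fun i => b i j = 0),
        (linForm (b i ∘ j.succAbove) (vecCast y))⁻¹) *
        ∏ i ∈ R.filter (fun i => b i j ≠ 0), (b i j + linForm (b i ∘ j.succAbove) (vecCast y))⁻¹) *
        G (p, j.insertNth (u : ℂ) ((u : ℂ) • vecCast y)) * h2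

lemma analyticAt_insertNth {F : Type} [NormedAddCommGroup F] [NormedSpace ℂ F] {m : ℕ}
    (j : Fin (m + 1)) {f : F → ℂ} {g : F → Fin m → ℂ} {z : F} (hf : AnalyticAt ℂ f z)
    (hg : AnalyticAt ℂ g z) :
    AnalyticAt ℂ (fun z => (j.insertNth (f z) (g z) : Fin (m + 1) → ℂ)) z := by
  rw [analyticAt_pi_iff]
  rw [Fin.forall_iff_succAbove j]
  refine ⟨by simpa using hf, fun k => ?_⟩
  simpa using (analyticAt_pi_iff.1 hg) k

lemma analyticAt_linForm {m : ℕ} (b : Fin m → ℂ) (x : Fin m → ℂ) :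
    AnalyticAt ℂ (linForm b) x := by
  unfold linForm
  refine Finset.analyticAt_fun_sum _ fun j _ => ?_
  exact ((ContinuousLinearMap.proj (R := ℂ) (φ := fun _ : Fin m => ℂ) j).analyticAt x).mul
    analyticAt_const

lemma analyticAt_sectorFactor {E : Type} [NormedAddCommGroup E] [NormedSpace ℂ E]
    {N m : ℕ} {b : Fin N → Fin (m + 1) → ℂ} (hb : ∀ i j, b i j = 0 ∨ 0 < (b i j).re)
    (R : Finset (Fin N))
    {G : E × (Fin (m + 1) → ℂ) → ℂ} (j : Fin (m + 1)) {p : E}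
    (hG : ∀ x : Fin (m + 1) → ℝ, (∀ i, x i ∈ Icc (0 : ℝ) 1) → AnalyticAt ℂ G (p, vecCast x))
    {u : ℝ} (hu : u ∈ Icc (0 : ℝ) 1) {y : Fin m → ℝ} (hy : ∀ i, y i ∈ Icc (0 : ℝ) 1) :
    AnalyticAt ℂ (sectorFactor b R G j) ((p, (u : ℂ)), vecCast y) := by
  have hu2 : AnalyticAt ℂ (fun z : (E × ℂ) × (Fin m → ℂ) => z.1.2) ((p, (u : ℂ)), vecCast y) :=
    analyticAt_snd.comp analyticAt_fst
  refine (AnalyticAt.mul ?_ (Finset.analyticAt_fun_prod _ fun i hi => ?_)).mul (hu2.pow _)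
  · have h1 : AnalyticAt ℂ G (p, j.insertNth (u : ℂ) ((u : ℂ) • vecCast y)) := by
      rw [← vecCast_insertNth]
      refine hG _ ?_
      rw [Fin.forall_iff_succAbove j]
      refine ⟨by simpa using hu, fun k => ?_⟩
      simp only [Fin.insertNth_apply_succAbove, Pi.smul_apply, smul_eq_mul]
      exact ⟨mul_nonneg hu.1 (hy k).1, mul_le_one₀ hu.2 (hy k).1 (hy k).2⟩
    exact AnalyticAt.fun_comp (f := fun z : (E × ℂ) × (Fin m → ℂ) =>
      (z.1.1, (j.insertNth z.1.2 (z.1.2 • z.2) : Fin (m + 1) → ℂ))) h1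
      ((analyticAt_fst.comp analyticAt_fst).prod
      (analyticAt_insertNth j hu2 (hu2.smul analyticAt_snd)))
  · refine AnalyticAt.inv (analyticAt_const.add
      ((analyticAt_linForm _ _).comp analyticAt_snd)) ?_
    have h1 := re_linForm_nonneg (b := b i ∘ j.succAbove) (fun k => hb i _) (fun k => (hy k).1)
    have h2 := (hb i j).resolve_left (Finset.mem_filter.1 hi).2
    intro h
    have := congrArg Complex.re h
    simp at this
    linarith

/-- Integration over the unit cube by singling out the first coordinate. -/
lemma integral_cube_succ {m : ℕ} {f : (Fin (m + 1) → ℝ) → ℂ} (hf : IntegrableOn f (cube (m + 1))) :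
    (∀ᵐ u ∂volume.restrict (Ioo (0 : ℝ) 1),
      IntegrableOn (fun y => f ((0 : Fin (m + 1)).insertNth u y)) (cube m)) ∧
    ∫ x in cube (m + 1), f x =
      ∫ u in Ioo (0 : ℝ) 1, ∫ y in cube m, f ((0 : Fin (m + 1)).insertNth u y) := by
  have hmp := (volume_preserving_piFinSuccAbove (fun _ : Fin (m + 1) => ℝ) 0).symm
  have hpre : (MeasurableEquiv.piFinSuccAbove (fun _ : Fin (m + 1) => ℝ) 0).symm ⁻¹' cube (m + 1) =
      Ioo (0 : ℝ) 1 ×ˢ cube m := by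
    ext ⟨u, y⟩
    simp only [cube, mem_preimage, mem_univ_pi, mem_prod]
    rw [Fin.forall_iff_succAbove 0]
    simp [MeasurableEquiv.piFinSuccAbove, Fin.insertNthEquiv]
  have h1 : IntegrableOn (fun z : ℝ × (Fin m → ℝ) => f ((0 : Fin (m + 1)).insertNth z.1 z.2))
      (Ioo (0 : ℝ) 1 ×ˢ cube m) (volume.prod volume) := by
    rw [← hpre]
    exact (hmp.integrableOn_comp_preimage (MeasurableEquiv.measurableEmbedding _)).2 hf
  constructor
  · rw [IntegrableOn, ← Measure.prod_restrict] at h1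
    exact h1.prod_right_ae
  · rw [← setIntegral_prod _ h1, ← hpre]
    exact (hmp.setIntegral_preimage_emb (MeasurableEquiv.measurableEmbedding _) f _).symm

lemma cubeIntegrand_insertNth_zero {E : Type} {N m : ℕ} (σ : E → ℂ) (b : Fin N → Fin (m + 1) → ℂ)
    (G : E × (Fin (m + 1) → ℂ) → ℂ) (p : E) (u : ℝ) (y : Fin m → ℝ) :
    cubeIntegrand σ b ∅ G p ((0 : Fin (m + 1)).insertNth u y) =
      (u : ℂ) ^ (σ p - 1) *
        cubeIntegrand (fun z : E × ℂ => σ z.1) (fun i => b i ∘ (0 : Fin (m + 1)).succAbove) ∅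
          (fun z => G (z.1.1, (0 : Fin (m + 1)).insertNth z.1.2 z.2)) (p, (u : ℂ)) y := by
  simp only [cubeIntegrand, Finset.prod_empty, vecCast_insertNth']
  rw [Fin.prod_univ_succAbove _ 0]
  simp only [Fin.insertNth_apply_same, Fin.insertNth_apply_succAbove]
  ring

lemma card_filter_comp_succAbove {m : ℕ} (b : Fin (m + 1) → ℂ) (j : Fin (m + 1)) (hj : b j = 0) :
    (Finset.univ.filter fun k => (b ∘ j.succAbove) k ≠ 0).card =
      (Finset.univ.filter fun k => b k ≠ 0).card := by
  rw [← Finset.card_map j.succAboveEmb]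
  congr 1
  ext k
  simp only [Finset.mem_map, Finset.mem_filter, Finset.mem_univ, true_and, Function.comp,
    Fin.succAboveEmb_apply]
  constructor
  · rintro ⟨l, hl, rfl⟩; exact hl
  · intro hk
    have hne : k ≠ j := by rintro rfl; exact hk hj
    obtain ⟨l, rfl⟩ := Fin.exists_succAbove_eq hne
    exact ⟨l, hk, rfl⟩

lemma ae_of_mul_integrableOn {m : ℕ} {c : ℂ} (hc : c ≠ 0) {f : (Fin m → ℝ) → ℂ}
    (h : IntegrableOn (fun y => c * f y) (cube m)) : IntegrableOn f (cube m) := by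
  have := h.const_mul c⁻¹
  refine this.congr (Eventually.of_forall fun y => ?_)
  simp [hc]

/-- The integral over the cube is a product of Gamma factors and a function which is
analytic in the parameter. -/
theorem exists_analytic_cube (N q : ℕ) (hq : 1 ≤ q) (m : ℕ) :
    ∀ (E : Type) [NormedAddCommGroup E] [NormedSpace ℂ E] [FiniteDimensional ℂ E]
      (σ : E → ℂ) (_ : ∀ p, AnalyticAt ℂ σ p) (b : Fin N → Fin m → ℂ)
      (_ : ∀ i j, b i j = 0 ∨ 0 < (b i j).re) (R : Finset (Fin N))
      (_ : ∀ i ∈ R, q ≤ (Finset.univ.filter fun j => b i j ≠ 0).card)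
      (G : E × (Fin m → ℂ) → ℂ),
    ∃ h : E → ℂ, ∀ p,
      (∀ x : Fin m → ℝ, (∀ j, x j ∈ Icc (0 : ℝ) 1) → AnalyticAt ℂ G (p, vecCast x)) →
      AnalyticAt ℂ h p ∧ ((N : ℝ) / q < (σ p).re →
        IntegrableOn (cubeIntegrand σ b R G p) (cube m) →
        ∫ x in cube m, cubeIntegrand σ b R G p x = gammaProd q N m (σ p) * h p) := by
  have hq0 : (0 : ℝ) < q := by exact_mod_cast hq
  have hNq : (0 : ℝ) ≤ (N : ℝ) / q := by positivity
  induction m with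
  | zero =>
    intro E _ _ _ σ hσ b hb R hR G
    refine ⟨fun p => G (p, vecCast 0), fun p hp => ⟨?_, fun _ _ => ?_⟩⟩
    · exact AnalyticAt.fun_comp (f := fun p => (p, vecCast 0)) (hp 0 fun j => j.elim0)
        (analyticAt_id.prod analyticAt_const)
    · have hR0 : R = ∅ := by
        refine Finset.eq_empty_of_forall_notMem fun i hi => ?_
        have := hR i hi
        simp at this
        omega
      have hc : cube 0 = univ := by ext; simp [cube]
      rw [hc, setIntegral_univ, volume_pi, Measure.pi_of_empty _ 0, integral_dirac]
      simp [cubeIntegrand, gammaProd, hR0]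
  | succ m ih =>
    intro E _ _ _ σ hσ b hb R hR G
    have hσ' : ∀ z : E × ℂ, AnalyticAt ℂ (fun z : E × ℂ => σ z.1) z := fun z =>
      (hσ z.1).fun_comp analyticAt_fst
    have hg1 : gammaProd q N (m + 1) = fun s => gammaProd q N m s *
        (if q ≤ m + 1 then Complex.Gamma (((m : ℂ) + 1) * s - N) else Complex.Gamma s) := by
      ext s; simp [gammaProd, Finset.prod_range_succ]
    by_cases hm : q ≤ m + 1
    · have hstep : ∀ j : Fin (m + 1), ∃ h : E → ℂ, ∀ p,
          (∀ x : Fin (m + 1) → ℝ, (∀ j, x j ∈ Icc (0 : ℝ) 1) → AnalyticAt ℂ G (p, vecCast x)) →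
          AnalyticAt ℂ h p ∧ ((N : ℝ) / q < (σ p).re →
          (∀ᵐ u ∂volume.restrict (Ioo (0 : ℝ) 1), IntegrableOn
            (fun y => cubeIntegrand σ b R G p (j.insertNth u (u • y))) (cube m)) →
          ∫ u in Ioo (0 : ℝ) 1, u ^ m • ∫ y in cube m,
            cubeIntegrand σ b R G p (j.insertNth u (u • y)) =
          gammaProd q N m (σ p) * Complex.Gamma (((m : ℂ) + 1) * σ p - N) * h p) := by
        intro j
        obtain ⟨h', hh'⟩ := ih (E × ℂ) (fun z => σ z.1) hσ' (fun i => b i ∘ j.succAbove)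
          (fun i k => hb i _) (R.filter fun i => b i j = 0) (fun i hi => by
            rw [Finset.mem_filter] at hi
            have := card_filter_comp_succAbove (b i) j hi.2
            exact this ▸ hR i hi.1) (sectorFactor b R G j)
        obtain ⟨h, hh⟩ := exists_analytic_mellin (E := E) (fun p => ((m : ℂ) + 1) * σ p - N)
          (fun p => (analyticAt_const.mul (hσ p)).sub analyticAt_const) h'
        refine ⟨h, fun p hp => ?_⟩
        have hG' : ∀ u : ℝ, u ∈ Icc (0 : ℝ) 1 → ∀ y : Fin m → ℝ, (∀ k, y k ∈ Icc (0 : ℝ) 1) →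
            AnalyticAt ℂ (sectorFactor b R G j) ((p, (u : ℂ)), vecCast y) :=
          fun u hu y hy => analyticAt_sectorFactor hb R j hp hu hy
        obtain ⟨ha, hI⟩ := hh p fun u hu => (hh' (p, (u : ℂ)) (hG' u hu)).1
        refine ⟨ha, fun hs hint => ?_⟩
        have hpos : 0 < (((m : ℂ) + 1) * σ p - N).re := by
          have h1 : (N : ℝ) < (σ p).re * q := (div_lt_iff₀ hq0).1 hs
          have h2 : (q : ℝ) ≤ m + 1 := by exact_mod_cast hm
          have h3 : (((m : ℂ) + 1) * σ p - N).re = ((m : ℝ) + 1) * (σ p).re - N := by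
            simp
          rw [h3]
          nlinarith [hNq]
        rw [mul_assoc, ← hI hpos, ← integral_const_mul]
        refine integral_congr_ae ?_
        filter_upwards [hint, ae_restrict_mem measurableSet_Ioo] with u hu hu01
        have hu0 : (u : ℂ) ≠ 0 := ofReal_ne_zero.2 hu01.1.ne'
        have hc0 : ((u : ℂ) ^ m)⁻¹ * (u : ℂ) ^ ((((m : ℂ) + 1) * σ p - N) - 1) ≠ 0 :=
          mul_ne_zero (inv_ne_zero (pow_ne_zero _ hu0)) (by simp [cpow_eq_zero_iff, hu0])
        have heq : ∀ y ∈ cube m, cubeIntegrand σ b R G p (j.insertNth u (u • y)) =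
            (((u : ℂ) ^ m)⁻¹ * (u : ℂ) ^ ((((m : ℂ) + 1) * σ p - N) - 1)) *
            cubeIntegrand (fun z : E × ℂ => σ z.1) (fun i => b i ∘ j.succAbove)
            (R.filter (fun i => b i j = 0)) (sectorFactor b R G j) (p, (u : ℂ)) y := by
          intro y hy
          rw [mul_assoc, ← cubeIntegrand_insertNth σ b R G j p hu01.1 hy]
          field_simp
        rw [setIntegral_congr_fun (measurableSet_cube m) heq, integral_const_mul,
          (hh' (p, (u : ℂ)) (hG' u (Ioo_subset_Icc_self hu01))).2 hs
          (ae_of_mul_integrableOn hc0 ((integrableOn_congr_fun heq (measurableSet_cube m)).1 hu))]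
        rw [real_smul]
        push_cast
        field_simp
      choose h hh using hstep
      refine ⟨fun p => ∑ j, h j p, fun p hp => ⟨?_, fun hs hint => ?_⟩⟩
      · exact Finset.analyticAt_fun_sum _ fun j _ => (hh j p hp).1
      · have hA1 : ∀ u ∈ Ioo (0 : ℝ) 1, ∀ v, 0 < v → v < u → v ∈ Ioo (0 : ℝ) 1 :=
          fun u hu v h0 h1 => ⟨h0, h1.trans hu.2⟩
        have hA0 : Ioo (0 : ℝ) 1 ⊆ Ioi 0 := fun u hu => hu.1
        have := integral_pi_eq_sum_sector measurableSet_Ioo hA0 hA1 hint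
        rw [cube, this, hg1]
        simp only [hm, if_true]
        rw [Finset.mul_sum]
        refine Finset.sum_congr rfl fun j _ => (hh j p hp).2 hs ?_
        exact ae_integrableOn_section measurableSet_Ioo hA0 j
          (hint.mono_set (sector_subset_pi j hA1))
    · have hR0 : R = ∅ := by
        refine Finset.eq_empty_of_forall_notMem fun i hi => ?_
        have h1 := hR i hi
        have h2 := Finset.card_le_univ (Finset.univ.filter fun j => b i j ≠ 0)
        simp only [Fintype.card_fin] at h2
        omega
      subst hR0
      obtain ⟨h', hh'⟩ := ih (E × ℂ) (fun z => σ z.1) hσ'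
        (fun i => b i ∘ (0 : Fin (m + 1)).succAbove)
        (fun i k => hb i _) ∅ (by simp) (fun z => G (z.1.1, (0 : Fin (m + 1)).insertNth z.1.2 z.2))
      obtain ⟨h, hh⟩ := exists_analytic_mellin σ hσ h'
      refine ⟨h, fun p hp => ?_⟩
      have hG' : ∀ u : ℝ, u ∈ Icc (0 : ℝ) 1 → ∀ y : Fin m → ℝ, (∀ k, y k ∈ Icc (0 : ℝ) 1) →
          AnalyticAt ℂ (fun z : (E × ℂ) × (Fin m → ℂ) =>
            G (z.1.1, (0 : Fin (m + 1)).insertNth z.1.2 z.2)) ((p, (u : ℂ)), vecCast y) := by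
        intro u hu y hy
        have hu2 : AnalyticAt ℂ (fun z : (E × ℂ) × (Fin m → ℂ) => z.1.2) ((p, (u : ℂ)), vecCast y) :=
          analyticAt_snd.comp analyticAt_fst
        have h1 : AnalyticAt ℂ G (p, (0 : Fin (m + 1)).insertNth (u : ℂ) (vecCast y)) := by
          rw [← vecCast_insertNth']
          refine hp _ ?_
          rw [Fin.forall_iff_succAbove 0]
          exact ⟨by simpa using hu, fun k => by simpa using hy k⟩
        exact AnalyticAt.fun_comp (f := fun z : (E × ℂ) × (Fin m → ℂ) =>
          (z.1.1, ((0 : Fin (m + 1)).insertNth z.1.2 z.2 : Fin (m + 1) → ℂ))) h1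
          ((analyticAt_fst.comp analyticAt_fst).prod (analyticAt_insertNth 0 hu2 analyticAt_snd))
      obtain ⟨ha, hI⟩ := hh p fun u hu => (hh' (p, (u : ℂ)) (hG' u hu)).1
      refine ⟨ha, fun hs hint => ?_⟩
      obtain ⟨hae, heq⟩ := integral_cube_succ hint
      rw [heq, hg1]
      simp only [hm, if_false]
      rw [mul_assoc, ← hI (hNq.trans_lt hs), ← integral_const_mul]
      refine integral_congr_ae ?_
      filter_upwards [hae, ae_restrict_mem measurableSet_Ioo] with u hu hu01
      have hu0 : (u : ℂ) ≠ 0 := ofReal_ne_zero.2 hu01.1.ne'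
      simp_rw [cubeIntegrand_insertNth_zero] at hu ⊢
      rw [integral_const_mul, (hh' (p, (u : ℂ)) (hG' u (Ioo_subset_Icc_self hu01))).2 hs
        (ae_of_mul_integrableOn (by simp [cpow_eq_zero_iff, hu0]) hu)]
      ring

/-- The open positive orthant. -/
def posOrthant (n : ℕ) : Set (Fin n → ℝ) := univ.pi fun _ => Ioi (0 : ℝ)

lemma measurableSet_posOrthant (n : ℕ) : MeasurableSet (posOrthant n) :=
  MeasurableSet.univ_pi fun _ => measurableSet_Ioi

lemma restrict_posOrthant (n : ℕ) : (volume : Measure (Fin n → ℝ)).restrict (posOrthant n) =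
    Measure.pi fun _ => volume.restrict (Ioi (0 : ℝ)) := by
  rw [posOrthant, volume_pi, Measure.restrict_pi_pi]

lemma norm_cpow_mul_exp {s c : ℂ} {t : ℝ} (ht : 0 < t) :
    ‖(t : ℂ) ^ (s - 1) * cexp (-(c * t))‖ = t ^ (s.re - 1) * Real.exp (-(c.re * t)) := by
  rw [norm_mul, norm_cpow_eq_rpow_re_of_pos ht, norm_exp]
  simp

lemma integrableOn_cpow_mul_exp {s c : ℂ} (hs : 0 < s.re) (hc : 0 < c.re) :
    IntegrableOn (fun t : ℝ => (t : ℂ) ^ (s - 1) * cexp (-(c * t))) (Ioi 0) := by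
  have h := integrableOn_rpow_mul_exp_neg_mul_rpow (s := s.re - 1) (p := 1) (b := c.re)
    (by linarith) one_pos hc
  refine Integrable.mono' h ?_ ?_
  · refine (Measurable.mul ?_ ?_).aestronglyMeasurable
    · exact measurable_ofReal.pow_const _
    · fun_prop
  · filter_upwards [ae_restrict_mem measurableSet_Ioi] with t ht
    rw [norm_cpow_mul_exp ht]
    simp

lemma integral_cpow_mul_exp {s c : ℂ} (hs : 0 < s.re) (hc : 0 < c.re) :
    ∫ t in Ioi (0 : ℝ), (t : ℂ) ^ (s - 1) * cexp (-(c * t)) = Complex.Gamma s * c ^ (-s) := by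
  have hU : IsOpen {c : ℂ | 0 < c.re} := isOpen_lt continuous_const continuous_re
  have hconv : IsPreconnected {c : ℂ | 0 < c.re} := (convex_halfSpace_re_gt 0).isPreconnected
  have hL : AnalyticOnNhd ℂ (fun c : ℂ => ∫ t in Ioi (0 : ℝ), (t : ℂ) ^ (s - 1) * cexp (-(c * t)))
      {c : ℂ | 0 < c.re} := by
    intro c hc
    change 0 < c.re at hc
    have hre : ∀ c' ∈ ball c (c.re / 2), c.re / 2 < c'.re := by
      intro c' hc'
      have h1 := (abs_re_le_norm (c' - c)).trans_lt (mem_ball_iff_norm.1 hc')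
      rw [sub_re] at h1
      linarith [(abs_lt.1 h1).1]
    refine analyticAt_integral_of_bound (k := fun (c : ℂ) (t : ℝ) => (t : ℂ) ^ (s - 1) * cexp (-(c * t)))
      (half_pos hc) (B := fun t : ℝ => t ^ (s.re - 1) * Real.exp (-((c.re / 2) * t))) ?_ ?_ ?_ ?_
    · have h := integrableOn_rpow_mul_exp_neg_mul_rpow (s := s.re - 1) (p := 1) (b := c.re / 2)
        (by linarith) one_pos (half_pos hc)
      simpa [IntegrableOn] using h
    · intro c' hc'
      exact (integrableOn_cpow_mul_exp hs ((half_pos hc).trans (hre c' hc'))).aestronglyMeasurable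
    · filter_upwards [ae_restrict_mem measurableSet_Ioi] with t ht c' hc'
      rw [norm_cpow_mul_exp ht]
      refine mul_le_mul_of_nonneg_left (Real.exp_le_exp.2 (neg_le_neg ?_))
        (Real.rpow_nonneg (le_of_lt ht) _)
      exact mul_le_mul_of_nonneg_right (hre c' hc').le (le_of_lt ht)
    · refine Eventually.of_forall fun t => Differentiable.differentiableOn ?_
      fun_prop
  have hR : AnalyticOnNhd ℂ (fun c : ℂ => Complex.Gamma s * c ^ (-s)) {c : ℂ | 0 < c.re} := by
    intro c hc
    exact analyticAt_const.mul (analyticAt_id.cpow analyticAt_const (Or.inl hc))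
  refine hL.eqOn_of_preconnected_of_frequently_eq hR hconv (z₀ := 1) (by simp) ?_ hc
  have ht : Tendsto (fun k : ℕ => (((1 + 1 / ((k : ℝ) + 1) : ℝ)) : ℂ)) atTop (𝓝[≠] 1) := by
    rw [tendsto_nhdsWithin_iff]
    constructor
    · have h1 : Tendsto (fun k : ℕ => (1 + 1 / ((k : ℝ) + 1) : ℝ)) atTop (𝓝 (1 + 0)) :=
        tendsto_const_nhds.add tendsto_one_div_add_atTop_nhds_zero_nat
      have h2 := (continuous_ofReal.tendsto _).comp h1
      rw [add_zero, ofReal_one] at h2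
      exact h2
    · refine Eventually.of_forall fun k => ?_
      have h1 : (0 : ℝ) < 1 / ((k : ℝ) + 1) := by positivity
      rw [mem_compl_iff, mem_singleton_iff, ← ofReal_one, ofReal_inj]
      linarith
  refine ht.frequently (Frequently.of_forall fun k => ?_)
  have h1 : (0 : ℝ) < 1 + 1 / ((k : ℝ) + 1) := by positivity
  rw [Complex.integral_cpow_mul_exp_neg_mul_Ioi hs h1, one_div, inv_cpow, cpow_neg, mul_comm]
  rw [arg_ofReal_of_nonneg h1.le]
  exact Real.pi_pos.ne

lemma integral_norm_cpow_mul_exp {s c : ℂ} (hs : 0 < s.re) (hc : 0 < c.re) :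
    ∫ t in Ioi (0 : ℝ), ‖(t : ℂ) ^ (s - 1) * cexp (-(c * t))‖ =
      Real.Gamma s.re * c.re ^ (-s.re) := by
  rw [setIntegral_congr_fun measurableSet_Ioi fun t ht => norm_cpow_mul_exp ht,
    Real.integral_rpow_mul_exp_neg_mul_Ioi hs hc, one_div, Real.inv_rpow hc.le, Real.rpow_neg hc.le,
    mul_comm]

/-- Lower bound `1 + ∑ t ≥ ∏ (1 + t)^(1/N)`. -/
lemma prod_one_add_rpow_le {N : ℕ} (hN : 0 < N) (Q : Finset (Fin N)) {t : Fin N → ℝ}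
    (ht : ∀ i, 0 < t i) : ∏ i ∈ Q, (1 + t i) ^ ((N : ℝ)⁻¹) ≤ 1 + ∑ i ∈ Q, t i := by
  have hN' : (0 : ℝ) < N := by exact_mod_cast hN
  have hS : 1 ≤ 1 + ∑ i ∈ Q, t i := by
    have := Finset.sum_nonneg fun i (_ : i ∈ Q) => (ht i).le
    linarith
  calc ∏ i ∈ Q, (1 + t i) ^ ((N : ℝ)⁻¹) ≤ ∏ i ∈ Q, (1 + ∑ i ∈ Q, t i) ^ ((N : ℝ)⁻¹) := by
        refine Finset.prod_le_prod (fun i _ => Real.rpow_nonneg (by linarith [ht i]) _) fun i hi => ?_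
        refine Real.rpow_le_rpow (by linarith [ht i]) ?_ (by positivity)
        have := Finset.single_le_sum (f := t) (fun i _ => (ht i).le) hi
        linarith
    _ = (1 + ∑ i ∈ Q, t i) ^ ((Q.card : ℝ) * (N : ℝ)⁻¹) := by
        rw [Finset.prod_const, ← Real.rpow_natCast, ← Real.rpow_mul (by linarith), mul_comm]
    _ ≤ (1 + ∑ i ∈ Q, t i) ^ (1 : ℝ) := by
        refine Real.rpow_le_rpow_of_exponent_le hS ?_
        rw [mul_inv_le_iff₀ hN', one_mul]
        exact_mod_cast (by simpa using Finset.card_le_univ Q)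
    _ = _ := Real.rpow_one _

section
variable {N n : ℕ}

/-- The `j`-th affine factor of the zeta integrand. -/
def affineForm (a : Fin N → Fin n → ℂ) (w : Fin n → ℂ) (t : Fin N → ℝ) (j : Fin n) : ℂ :=
  w j + ∑ i, (t i : ℂ) * a i j

lemma re_affineForm (a : Fin N → Fin n → ℂ) (w : Fin n → ℂ) (t : Fin N → ℝ) (j : Fin n) :
    (affineForm a w t j).re = (w j).re + ∑ i, t i * (a i j).re := by
  simp [affineForm]

lemma exists_affineForm_lower (hN : 0 < N) {a : Fin N → Fin n → ℂ}
    (ha : ∀ i j, a i j = 0 ∨ 0 < (a i j).re) {w : Fin n → ℂ} (hw : ∀ j, 0 < (w j).re) :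
    ∃ δ : ℝ, 0 < δ ∧ ∀ j, ∀ t : Fin N → ℝ, (∀ i, 0 < t i) →
      δ * ∏ i ∈ Finset.univ.filter (fun i => a i j ≠ 0), (1 + t i) ^ ((N : ℝ)⁻¹) ≤
        (affineForm a w t j).re := by
  have h1 : ∃ δ : ℝ, 0 < δ ∧ (∀ j, δ ≤ (w j).re) ∧ ∀ i j, a i j ≠ 0 → δ ≤ (a i j).re := by
    have e1 : ∀ᶠ δ in 𝓝[>] (0 : ℝ), ∀ j, δ ≤ (w j).re := by
      rw [eventually_all]
      exact fun j => Filter.Eventually.filter_mono nhdsWithin_le_nhds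
        (Iio_mem_nhds (hw j) |> fun h => by filter_upwards [h] with x hx using le_of_lt hx)
    have e2 : ∀ᶠ δ in 𝓝[>] (0 : ℝ), ∀ i j, a i j ≠ 0 → δ ≤ (a i j).re := by
      rw [eventually_all]; intro i
      rw [eventually_all]; intro j
      by_cases h : a i j = 0
      · exact Eventually.of_forall fun _ h' => absurd h h'
      · have h' := (ha i j).resolve_left h
        exact Filter.Eventually.filter_mono nhdsWithin_le_nhds
          (Iio_mem_nhds h' |> fun h => by filter_upwards [h] with x hx _ using le_of_lt hx)
    obtain ⟨δ, ⟨h1, h2⟩, h3⟩ := ((e1.and e2).and self_mem_nhdsWithin).exists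
    exact ⟨δ, h3, h1, h2⟩
  obtain ⟨δ, hδ, hδw, hδa⟩ := h1
  refine ⟨δ, hδ, fun j t ht => ?_⟩
  refine (mul_le_mul_of_nonneg_left (prod_one_add_rpow_le hN _ ht) hδ.le).trans ?_
  rw [re_affineForm, mul_add, mul_one, Finset.mul_sum, Finset.sum_filter]
  refine add_le_add (hδw j) (Finset.sum_le_sum fun i _ => ?_)
  split_ifs with h
  · rw [mul_comm]
    exact mul_le_mul_of_nonneg_left (hδa i j h) (ht i).le
  · rw [not_not] at h
    simp [h]

lemma affineForm_re_pos {a : Fin N → Fin n → ℂ}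
    (ha : ∀ i j, a i j = 0 ∨ 0 < (a i j).re) {w : Fin n → ℂ} (hw : ∀ j, 0 < (w j).re)
    {t : Fin N → ℝ} (ht : ∀ i, 0 < t i) (j : Fin n) : 0 < (affineForm a w t j).re := by
  rw [re_affineForm]
  refine add_pos_of_pos_of_nonneg (hw j) (Finset.sum_nonneg fun i _ => mul_nonneg (ht i).le ?_)
  rcases ha i j with h | h
  · simp [h]
  · exact h.le

lemma measurable_affineForm_re (a : Fin N → Fin n → ℂ) (w : Fin n → ℂ) (j : Fin n) :
    Measurable fun t => (affineForm a w t j).re := by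
  simp only [re_affineForm]
  fun_prop

lemma integrableOn_prod_affineForm (hN : 0 < N) {q : ℕ} (hq : 1 ≤ q) {a : Fin N → Fin n → ℂ}
    (ha : ∀ i j, a i j = 0 ∨ 0 < (a i j).re)
    (hrow : ∀ i, q ≤ (Finset.univ.filter fun j => a i j ≠ 0).card)
    {w : Fin n → ℂ} (hw : ∀ j, 0 < (w j).re) {σ : ℝ} (hσ : (N : ℝ) / q < σ) :
    IntegrableOn (fun t => ∏ j, (affineForm a w t j).re ^ (-σ)) (posOrthant N) := by
  obtain ⟨δ, hδ, hlow⟩ := exists_affineForm_lower hN ha hw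
  have hN' : (0 : ℝ) < N := by exact_mod_cast hN
  have hq' : (0 : ℝ) < q := by exact_mod_cast hq
  have hσ0 : 0 < σ := (by positivity : (0 : ℝ) ≤ (N : ℝ) / q).trans_lt hσ
  have hexp : -(σ * q / N) < -1 := by
    rw [neg_lt_neg_iff, lt_div_iff₀ hN', one_mul]
    exact (div_lt_iff₀ hq').1 hσ
  have h1 : IntegrableOn (fun t : Fin N → ℝ => ∏ i, (t i + 1) ^ (-(σ * q / N))) (posOrthant N) := by
    rw [IntegrableOn, restrict_posOrthant]
    exact Integrable.fintype_prod fun i => integrableOn_add_rpow_Ioi_of_lt hexp (by norm_num)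
  refine Integrable.mono' (h1.const_mul ((δ ^ (-σ)) ^ n)) ?_ ?_
  · refine (Finset.measurable_fun_prod _ fun j _ => ?_).aestronglyMeasurable
    exact (measurable_affineForm_re a w j).pow_const _
  · filter_upwards [ae_restrict_mem (measurableSet_posOrthant N)] with t ht
    have ht0 : ∀ i, 0 < t i := fun i => ht i trivial
    rw [Real.norm_of_nonneg (Finset.prod_nonneg fun j _ =>
      Real.rpow_nonneg (affineForm_re_pos ha hw ht0 j).le _)]
    have hb0 : ∀ i, 0 < 1 + t i := fun i => by linarith [ht0 i]
    have hP : ∀ j, 0 < ∏ i ∈ Finset.univ.filter (fun i => a i j ≠ 0), (1 + t i) ^ ((N : ℝ)⁻¹) :=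
      fun j => Finset.prod_pos fun i _ => Real.rpow_pos_of_pos (hb0 i) _
    calc ∏ j, (affineForm a w t j).re ^ (-σ)
        ≤ ∏ j, (δ * ∏ i ∈ Finset.univ.filter (fun i => a i j ≠ 0), (1 + t i) ^ ((N : ℝ)⁻¹)) ^ (-σ) := by
          refine Finset.prod_le_prod (fun j _ =>
            Real.rpow_nonneg (affineForm_re_pos ha hw ht0 j).le _) fun j _ => ?_
          exact Real.rpow_le_rpow_of_nonpos (mul_pos hδ (hP j)) (hlow j t ht0) (by linarith)
      _ = (δ ^ (-σ)) ^ n * ∏ j, ∏ i, if a i j ≠ 0 then (1 + t i) ^ (-(σ / N)) else 1 := by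
          simp_rw [fun j => Real.mul_rpow hδ.le (hP j).le (z := -σ)]
          rw [Finset.prod_mul_distrib, Finset.prod_const, Finset.card_univ, Fintype.card_fin]
          congr 1
          refine Finset.prod_congr rfl fun j _ => ?_
          rw [← Real.finsetProd_rpow _ _ (fun i _ => Real.rpow_nonneg (hb0 i).le _),
            Finset.prod_filter]
          refine Finset.prod_congr rfl fun i _ => ?_
          split_ifs
          · rw [← Real.rpow_mul (hb0 i).le]
            congr 1
            field_simp
          · rfl
      _ = (δ ^ (-σ)) ^ n * ∏ i, ((1 + t i) ^ (-(σ / N))) ^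
            (Finset.univ.filter fun j => a i j ≠ 0).card := by
          rw [Finset.prod_comm]
          congr 1
          refine Finset.prod_congr rfl fun i _ => ?_
          rw [← Finset.prod_filter, Finset.prod_const]
      _ ≤ (δ ^ (-σ)) ^ n * ∏ i, (t i + 1) ^ (-(σ * q / N)) := by
          refine mul_le_mul_of_nonneg_left ?_ (pow_nonneg (Real.rpow_nonneg hδ.le _) _)
          refine Finset.prod_le_prod (fun i _ => pow_nonneg (Real.rpow_nonneg (hb0 i).le _) _)
            fun i _ => ?_
          rw [← Real.rpow_natCast, ← Real.rpow_mul (hb0 i).le, add_comm (t i)]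
          refine Real.rpow_le_rpow_of_exponent_le (by linarith [ht0 i]) ?_
          have h2 : (q : ℝ) ≤ (Finset.univ.filter fun j => a i j ≠ 0).card := by
            exact_mod_cast hrow i
          have h3 : 0 < σ / N := by positivity
          have : σ * q / N = σ / N * q := by ring
          rw [this]
          nlinarith
end

lemma integrableOn_prod_cpow_mul_exp {n : ℕ} {s : ℂ} (hs : 0 < s.re) {c : Fin n → ℂ}
    (hc : ∀ j, 0 < (c j).re) :
    IntegrableOn (fun x : Fin n → ℝ => ∏ j, ((x j : ℂ) ^ (s - 1) * cexp (-(c j * x j))))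
      (posOrthant n) := by
  rw [IntegrableOn, restrict_posOrthant]
  exact Integrable.fintype_prod (f := fun j (t : ℝ) => (t : ℂ) ^ (s - 1) * cexp (-(c j * t)))
    fun j => integrableOn_cpow_mul_exp hs (hc j)

lemma integral_prod_cpow_mul_exp {n : ℕ} {s : ℂ} (hs : 0 < s.re) {c : Fin n → ℂ}
    (hc : ∀ j, 0 < (c j).re) :
    ∫ x in posOrthant n, ∏ j, ((x j : ℂ) ^ (s - 1) * cexp (-(c j * x j))) =
      Complex.Gamma s ^ n * ∏ j, c j ^ (-s) := by
  rw [restrict_posOrthant,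
    integral_fintype_prod_eq_prod (f := fun j (t : ℝ) => (t : ℂ) ^ (s - 1) * cexp (-(c j * t)))]
  simp_rw [fun j => integral_cpow_mul_exp hs (hc j)]
  rw [Finset.prod_mul_distrib, Finset.prod_const, Finset.card_univ, Fintype.card_fin]

lemma integral_norm_prod_cpow_mul_exp {n : ℕ} {s : ℂ} (hs : 0 < s.re) {c : Fin n → ℂ}
    (hc : ∀ j, 0 < (c j).re) :
    ∫ x in posOrthant n, ‖∏ j, ((x j : ℂ) ^ (s - 1) * cexp (-(c j * x j)))‖ =
      Real.Gamma s.re ^ n * ∏ j, (c j).re ^ (-s.re) := by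
  simp_rw [norm_prod]
  rw [restrict_posOrthant,
    integral_fintype_prod_eq_prod (f := fun j (t : ℝ) => ‖(t : ℂ) ^ (s - 1) * cexp (-(c j * t))‖)]
  simp_rw [fun j => integral_norm_cpow_mul_exp hs (hc j)]
  rw [Finset.prod_mul_distrib, Finset.prod_const, Finset.card_univ, Fintype.card_fin]

lemma integral_prod_exp {N : ℕ} {c : Fin N → ℂ} (hc : ∀ j, 0 < (c j).re) :
    ∫ t in posOrthant N, ∏ i, cexp (-(c i * t i)) = ∏ i, (c i)⁻¹ := by
  have := integral_prod_cpow_mul_exp (s := 1) (by simp) hc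
  simpa [cpow_neg_one] using this

section
variable {N n : ℕ}

/-- The integrand on the orthant after applying the Gamma integral to each factor. -/
def orthantIntegrand (a : Fin N → Fin n → ℂ) (s : ℂ) (w : Fin n → ℂ) (x : Fin n → ℝ) : ℂ :=
  (∏ j, ((x j : ℂ) ^ (s - 1) * cexp (-(w j * x j)))) * ∏ i, (linForm (a i) (vecCast x))⁻¹

lemma re_linForm_pos {b : Fin n → ℂ} (hb : ∀ j, b j = 0 ∨ 0 < (b j).re)
    (hb0 : ∃ j, b j ≠ 0) {x : Fin n → ℝ} (hx : ∀ j, 0 < x j) :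
    0 < (linForm b (vecCast x)).re := by
  simp only [linForm, vecCast, re_sum, re_ofReal_mul]
  obtain ⟨j, hj⟩ := hb0
  refine Finset.sum_pos' (fun j _ => mul_nonneg (hx j).le ?_)
    ⟨j, Finset.mem_univ _, mul_pos (hx j) ((hb j).resolve_left hj)⟩
  rcases hb j with h | h
  · simp [h]
  · exact h.le

lemma prod_kernel_eq (a : Fin N → Fin n → ℂ) (s : ℂ) (w : Fin n → ℂ) (t : Fin N → ℝ)
    (x : Fin n → ℝ) :
    ∏ j, ((x j : ℂ) ^ (s - 1) * cexp (-(affineForm a w t j * x j))) =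
      (∏ j, ((x j : ℂ) ^ (s - 1) * cexp (-(w j * x j)))) *
        ∏ i, cexp (-(linForm (a i) (vecCast x) * t i)) := by
  rw [Finset.prod_mul_distrib, Finset.prod_mul_distrib, mul_assoc, ← exp_sum, ← exp_sum,
    ← exp_sum, ← exp_add]
  congr 2
  simp only [affineForm, linForm, vecCast, add_mul, neg_add, Finset.sum_add_distrib,
    Finset.sum_mul, Finset.sum_neg_distrib]
  congr 2
  rw [Finset.sum_comm]
  exact Finset.sum_congr rfl fun i _ => Finset.sum_congr rfl fun j _ => by ring

lemma measurable_kernel (a : Fin N → Fin n → ℂ) (s : ℂ) (w : Fin n → ℂ) :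
    Measurable fun z : (Fin N → ℝ) × (Fin n → ℝ) =>
      ∏ j, ((z.2 j : ℂ) ^ (s - 1) * cexp (-(affineForm a w z.1 j * z.2 j))) := by
  refine Finset.measurable_fun_prod _ fun j _ => Measurable.mul ?_ ?_
  · exact (measurable_ofReal.comp (by fun_prop : Measurable fun z : (Fin N → ℝ) × (Fin n → ℝ) =>
      z.2 j)).pow_const _
  · unfold affineForm
    fun_prop

theorem integral_orthantIntegrand (hN : 0 < N) {q : ℕ} (hq : 1 ≤ q) {a : Fin N → Fin n → ℂ}
    (ha : ∀ i j, a i j = 0 ∨ 0 < (a i j).re)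
    (hrow : ∀ i, q ≤ (Finset.univ.filter fun j => a i j ≠ 0).card)
    {w : Fin n → ℂ} (hw : ∀ j, 0 < (w j).re) {s : ℂ} (hs : (N : ℝ) / q < s.re) :
    IntegrableOn (orthantIntegrand a s w) (posOrthant n) ∧
    ∫ x in posOrthant n, orthantIntegrand a s w x =
      Complex.Gamma s ^ n * ∫ t in posOrthant N, ∏ j, affineForm a w t j ^ (-s) := by
  have hs0 : 0 < s.re := (by positivity : (0 : ℝ) ≤ (N : ℝ) / q).trans_lt hs
  have hint : Integrable (fun z : (Fin N → ℝ) × (Fin n → ℝ) =>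
      ∏ j, ((z.2 j : ℂ) ^ (s - 1) * cexp (-(affineForm a w z.1 j * z.2 j))))
      ((volume.restrict (posOrthant N)).prod (volume.restrict (posOrthant n))) := by
    rw [integrable_prod_iff (measurable_kernel a s w).aestronglyMeasurable]
    constructor
    · filter_upwards [ae_restrict_mem (measurableSet_posOrthant N)] with t ht
      exact integrableOn_prod_cpow_mul_exp hs0 (affineForm_re_pos ha hw fun i => ht i trivial)
    · refine ((integrableOn_prod_affineForm hN hq ha hrow hw hs).const_mul
        (Real.Gamma s.re ^ n)).congr ?_
      filter_upwards [ae_restrict_mem (measurableSet_posOrthant N)] with t ht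
      exact (integral_norm_prod_cpow_mul_exp hs0
        (affineForm_re_pos ha hw fun i => ht i trivial)).symm
  have hex : ∀ i, ∃ j, a i j ≠ 0 := by
    intro i
    obtain ⟨j, hj⟩ := Finset.card_pos.1 (hq.trans (hrow i))
    exact ⟨j, (Finset.mem_filter.1 hj).2⟩
  have hinner : ∀ x ∈ posOrthant n, ∫ t in posOrthant N,
      ∏ j, ((x j : ℂ) ^ (s - 1) * cexp (-(affineForm a w t j * x j))) =
        orthantIntegrand a s w x := by
    intro x hx
    simp_rw [prod_kernel_eq]
    rw [integral_const_mul, integral_prod_exp fun i => re_linForm_pos (ha i) (hex i)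
      fun j => hx j trivial]
    rfl
  constructor
  · refine hint.integral_prod_right.congr ?_
    filter_upwards [ae_restrict_mem (measurableSet_posOrthant n)] with x hx using hinner x hx
  · rw [← setIntegral_congr_fun (measurableSet_posOrthant n) hinner, ← integral_integral_swap hint,
      ← integral_const_mul]
    refine setIntegral_congr_fun (measurableSet_posOrthant N) fun t ht => ?_
    exact integral_prod_cpow_mul_exp hs0 (affineForm_re_pos ha hw fun i => ht i trivial)
end

section
variable {N m : ℕ}

/-- The analytic factor on the cube left after integrating out the radial variable. -/
def radialFactor (a : Fin N → Fin (m + 1) → ℂ) (j : Fin (m + 1))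
    (z : (ℂ × (Fin (m + 1) → ℂ)) × (Fin m → ℂ)) : ℂ :=
  (∏ i ∈ Finset.univ.filter (fun i => a i j ≠ 0), (a i j + linForm (a i ∘ j.succAbove) z.2)⁻¹) *
    (z.1.2 j + linForm (z.1.2 ∘ j.succAbove) z.2) ^ (-(((m : ℂ) + 1) * z.1.1 - N))

lemma orthantIntegrand_eq_cubeIntegrand (a : Fin N → Fin (m + 1) → ℂ) (s : ℂ)
    (w : Fin (m + 1) → ℂ) :
    orthantIntegrand a s w = cubeIntegrand Prod.fst a Finset.univ
      (fun z : (ℂ × (Fin (m + 1) → ℂ)) × (Fin (m + 1) → ℂ) => cexp (-linForm z.1.2 z.2)) (s, w) := by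
  ext x
  simp only [orthantIntegrand, cubeIntegrand]
  have hlin : linForm w (vecCast x) = ∑ j, w j * x j := Finset.sum_congr rfl fun j _ => mul_comm _ _
  rw [Finset.prod_mul_distrib, ← exp_sum, Finset.sum_neg_distrib, hlin]
  ring

lemma orthantIntegrand_insertNth (a : Fin N → Fin (m + 1) → ℂ) (s : ℂ)
    (w : Fin (m + 1) → ℂ) (j : Fin (m + 1)) {u : ℝ} (hu : 0 < u) {y : Fin m → ℝ}
    (hy : y ∈ cube m) :
    (u : ℂ) ^ m * orthantIntegrand a s w (j.insertNth u (u • y)) =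
      ((u : ℂ) ^ ((((m : ℂ) + 1) * s - N) - 1) *
          cexp (-((w j + linForm (w ∘ j.succAbove) (vecCast y)) * u))) *
        ((∏ k, (y k : ℂ) ^ (s - 1)) *
          (∏ i ∈ Finset.univ.filter (fun i => a i j = 0),
            (linForm (a i ∘ j.succAbove) (vecCast y))⁻¹) *
          ∏ i ∈ Finset.univ.filter (fun i => a i j ≠ 0),
            (a i j + linForm (a i ∘ j.succAbove) (vecCast y))⁻¹) := by
  rw [orthantIntegrand_eq_cubeIntegrand, cubeIntegrand_insertNth _ _ _ _ j _ hu hy]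
  simp only [cubeIntegrand, sectorFactor, linForm_insertNth, Finset.card_univ, Fintype.card_fin,
    Nat.sub_self, pow_zero, mul_one]
  rw [mul_comm (u : ℂ) (w j + _)]
  ring

lemma measurable_linForm_vecCast {n : ℕ} (b : Fin n → ℂ) :
    Measurable fun x : Fin n → ℝ => linForm b (vecCast x) := by
  unfold linForm vecCast
  fun_prop

lemma measurable_orthantIntegrand {n : ℕ} (a : Fin N → Fin n → ℂ) (s : ℂ) (w : Fin n → ℂ) :
    Measurable (orthantIntegrand a s w) := by
  refine (Finset.measurable_fun_prod _ fun j _ => Measurable.mul ?_ ?_).mul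
    (Finset.measurable_fun_prod _ fun i _ => (measurable_linForm_vecCast (a i)).inv)
  · exact (measurable_ofReal.comp (measurable_pi_apply j)).pow_const _
  · fun_prop

lemma measurable_insertNth_smul (j : Fin (m + 1)) :
    Measurable fun z : ℝ × (Fin m → ℝ) => (j.insertNth z.1 (z.1 • z.2) : Fin (m + 1) → ℝ) := by
  rw [measurable_pi_iff, Fin.forall_iff_succAbove j]
  refine ⟨by simpa using measurable_fst, fun k => ?_⟩
  simp only [Fin.insertNth_apply_succAbove, Pi.smul_apply, smul_eq_mul]
  fun_prop

lemma integral_radial (a : Fin N → Fin (m + 1) → ℂ) {s : ℂ} {w : Fin (m + 1) → ℂ}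
    (hw : ∀ k, 0 < (w k).re) (hs : 0 < (((m : ℂ) + 1) * s - N).re) (j : Fin (m + 1))
    (hf : IntegrableOn (orthantIntegrand a s w) (sector (Ioi 0) j)) :
    IntegrableOn (cubeIntegrand Prod.fst (fun i => a i ∘ j.succAbove)
      (Finset.univ.filter fun i => a i j = 0) (radialFactor a j) (s, w)) (cube m) ∧
    ∫ u in Ioi (0 : ℝ), u ^ m • ∫ y in cube m, orthantIntegrand a s w (j.insertNth u (u • y)) =
      Complex.Gamma (((m : ℂ) + 1) * s - N) * ∫ y in cube m,
        cubeIntegrand Prod.fst (fun i => a i ∘ j.succAbove)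
          (Finset.univ.filter fun i => a i j = 0) (radialFactor a j) (s, w) y := by
  have hΓ : Complex.Gamma (((m : ℂ) + 1) * s - N) ≠ 0 := Complex.Gamma_ne_zero_of_re_pos hs
  have hint : Integrable (fun z : ℝ × (Fin m → ℝ) =>
      (z.1 : ℂ) ^ m * orthantIntegrand a s w (j.insertNth z.1 (z.1 • z.2)))
      ((volume.restrict (Ioi 0)).prod (volume.restrict (cube m))) := by
    have hmeas : Measurable fun z : ℝ × (Fin m → ℝ) =>
      (z.1 : ℂ) ^ m * orthantIntegrand a s w (j.insertNth z.1 (z.1 • z.2)) :=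
      ((measurable_ofReal.comp measurable_fst).pow_const m).mul
        ((measurable_orthantIntegrand a s w).comp (measurable_insertNth_smul j))
    rw [integrable_prod_iff hmeas.aestronglyMeasurable]
    constructor
    · filter_upwards [ae_integrableOn_section measurableSet_Ioi subset_rfl j hf] with u hu
      exact hu.const_mul _
    · refine (integrableOn_section_norm measurableSet_Ioi subset_rfl j hf).congr ?_
      filter_upwards [ae_restrict_mem measurableSet_Ioi] with u hu
      simp_rw [norm_mul]
      rw [integral_const_mul, norm_pow, norm_real, Real.norm_of_nonneg (le_of_lt hu)]
  have hinner : ∀ y ∈ cube m, ∫ u in Ioi (0 : ℝ),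
      (u : ℂ) ^ m * orthantIntegrand a s w (j.insertNth u (u • y)) =
      Complex.Gamma (((m : ℂ) + 1) * s - N) *
        cubeIntegrand Prod.fst (fun i => a i ∘ j.succAbove)
          (Finset.univ.filter fun i => a i j = 0) (radialFactor a j) (s, w) y := by
    intro y hy
    have hW : 0 < (w j + linForm (w ∘ j.succAbove) (vecCast y)).re := by
      rw [add_re]
      exact add_pos_of_pos_of_nonneg (hw j) (re_linForm_nonneg (fun k => Or.inr (hw _))
        fun k => (hy k trivial).1.le)
    rw [setIntegral_congr_fun measurableSet_Ioi fun u hu =>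
      orthantIntegrand_insertNth a s w j hu hy, integral_mul_const, integral_cpow_mul_exp hs hW]
    simp only [cubeIntegrand, radialFactor]
    ring
  constructor
  · refine ae_of_mul_integrableOn hΓ (hint.integral_prod_right.congr ?_)
    filter_upwards [ae_restrict_mem (measurableSet_cube m)] with y hy using hinner y hy
  · rw [← integral_const_mul, ← setIntegral_congr_fun (measurableSet_cube m) hinner,
      ← integral_integral_swap hint]
    refine integral_congr_ae (Eventually.of_forall fun u => ?_)
    simp only [integral_const_mul, real_smul]
    push_cast
    rfl

lemma analyticAt_radialFactor {a : Fin N → Fin (m + 1) → ℂ}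
    (ha : ∀ i j, a i j = 0 ∨ 0 < (a i j).re) (j : Fin (m + 1)) {p : ℂ × (Fin (m + 1) → ℂ)}
    (hp : ∀ k, 0 < (p.2 k).re) {y : Fin m → ℝ} (hy : ∀ i, y i ∈ Icc (0 : ℝ) 1) :
    AnalyticAt ℂ (radialFactor a j) (p, vecCast y) := by
  refine AnalyticAt.mul (Finset.analyticAt_fun_prod _ fun i hi => ?_) (AnalyticAt.cpow ?_ ?_ ?_)
  · refine AnalyticAt.inv (analyticAt_const.add
      ((analyticAt_linForm _ _).comp analyticAt_snd)) ?_
    have h1 := re_linForm_nonneg (b := a i ∘ j.succAbove) (fun k => ha i _) (fun k => (hy k).1)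
    have h2 := (ha i j).resolve_left (Finset.mem_filter.1 hi).2
    intro h
    have := congrArg Complex.re h
    simp at this
    linarith
  · have hproj : ∀ k, AnalyticAt ℂ (fun z : (ℂ × (Fin (m + 1) → ℂ)) × (Fin m → ℂ) => z.1.2 k)
        (p, vecCast y) := fun k =>
      ((ContinuousLinearMap.proj (R := ℂ) (φ := fun _ : Fin (m + 1) => ℂ) k).analyticAt _).comp
        (analyticAt_snd.comp analyticAt_fst)
    have hproj' : ∀ k, AnalyticAt ℂ (fun z : (ℂ × (Fin (m + 1) → ℂ)) × (Fin m → ℂ) => z.2 k)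
        (p, vecCast y) := fun k =>
      ((ContinuousLinearMap.proj (R := ℂ) (φ := fun _ : Fin m => ℂ) k).analyticAt _).comp
        analyticAt_snd
    exact (hproj j).add (Finset.analyticAt_fun_sum _ fun k _ => (hproj' k).mul (hproj _))
  · exact ((analyticAt_const.mul (analyticAt_fst.comp analyticAt_fst)).sub analyticAt_const).neg
  · left
    rw [add_re]
    exact add_pos_of_pos_of_nonneg (hp j) (re_linForm_nonneg (fun k => Or.inr (hp _))
      fun k => (hy k).1)

/-- The integral over the orthant is a product of Gamma factors and an analytic function. -/
theorem exists_analytic_orthant (hN : 0 < N) {q : ℕ} (hq : 1 ≤ q) (hqm : q ≤ m + 1)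
    {a : Fin N → Fin (m + 1) → ℂ} (ha : ∀ i j, a i j = 0 ∨ 0 < (a i j).re)
    (hrow : ∀ i, q ≤ (Finset.univ.filter fun j => a i j ≠ 0).card) :
    ∃ h : ℂ × (Fin (m + 1) → ℂ) → ℂ,
      (∀ p, (∀ k, 0 < (p.2 k).re) → AnalyticAt ℂ h p) ∧
      ∀ s w, (N : ℝ) / q < s.re → (∀ k, 0 < (w k).re) →
        Complex.Gamma s ^ (m + 1) * ∫ t in posOrthant N, ∏ j, affineForm a w t j ^ (-s) =
          gammaProd q N (m + 1) s * h (s, w) := by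
  have hstep := fun j : Fin (m + 1) => exists_analytic_cube N q hq m (ℂ × (Fin (m + 1) → ℂ))
    Prod.fst (fun p => analyticAt_fst) (fun i => a i ∘ j.succAbove) (fun i k => ha i _)
    (Finset.univ.filter fun i => a i j = 0) (fun i hi => by
      rw [card_filter_comp_succAbove (a i) j (Finset.mem_filter.1 hi).2]
      exact hrow i) (radialFactor a j)
  choose h hh using hstep
  have hh' := fun j p (hp : ∀ k, 0 < ((p : ℂ × (Fin (m + 1) → ℂ)).2 k).re) =>
    hh j p fun x hx => analyticAt_radialFactor ha j hp hx
  have hg : ∀ s, gammaProd q N (m + 1) s =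
      gammaProd q N m s * Complex.Gamma (((m : ℂ) + 1) * s - N) := fun s => by
    simp [gammaProd, Finset.prod_range_succ, hqm]
  refine ⟨fun p => ∑ j, h j p, fun p hp => Finset.analyticAt_fun_sum _ fun j _ => (hh' j p hp).1,
    fun s w hs hw => ?_⟩
  have hq' : (0 : ℝ) < q := by exact_mod_cast hq
  have hpos : 0 < (((m : ℂ) + 1) * s - N).re := by
    have h1 : (N : ℝ) < s.re * q := (div_lt_iff₀ hq').1 hs
    have h2 : (q : ℝ) ≤ m + 1 := by exact_mod_cast hqm
    have h3 : (((m : ℂ) + 1) * s - N).re = ((m : ℝ) + 1) * s.re - N := by simp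
    have h4 : 0 < s.re := (by positivity : (0 : ℝ) ≤ (N : ℝ) / q).trans_lt hs
    rw [h3]
    nlinarith
  obtain ⟨hint, heq⟩ := integral_orthantIntegrand hN hq ha hrow hw hs
  have hA1 : ∀ u ∈ Ioi (0 : ℝ), ∀ v, 0 < v → v < u → v ∈ Ioi (0 : ℝ) := fun u hu v h0 h1 => h0
  rw [← heq, posOrthant, integral_pi_eq_sum_sector measurableSet_Ioi subset_rfl hA1 hint,
    Finset.mul_sum]
  refine Finset.sum_congr rfl fun j _ => ?_
  obtain ⟨hi, he⟩ := integral_radial a hw hpos j (hint.mono_set (sector_subset_pi j hA1))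
  rw [he, (hh' j (s, w) hw).2 hs hi, hg]
  ring
end

section

lemma inv_Gamma_eq_prod_mul (j : ℕ) (z : ℂ) :
    (Complex.Gamma z)⁻¹ = (∏ i ∈ Finset.range j, (z + i)) * (Complex.Gamma (z + j))⁻¹ := by
  induction j with
  | zero => simp
  | succ j ih =>
    rw [ih, Finset.prod_range_succ, one_div_Gamma_eq_self_mul_one_div_Gamma_add_one (z + j)]
    push_cast
    ring_nf

lemma exists_inv_Gamma_eq_mul (j : ℕ) :
    ∃ u : ℂ → ℂ, Differentiable ℂ u ∧ u (-j) ≠ 0 ∧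
      ∀ z, (Complex.Gamma z)⁻¹ = (z + j) * u z := by
  refine ⟨fun z => (∏ i ∈ Finset.range j, (z + i)) * (Complex.Gamma (z + (j + 1)))⁻¹, ?_, ?_,
    fun z => ?_⟩
  · refine Differentiable.mul (by fun_prop) ?_
    exact differentiable_one_div_Gamma.comp (differentiable_id.add_const _)
  · refine mul_ne_zero (Finset.prod_ne_zero_iff.2 fun i hi h => ?_) (by simp)
    have hij : (i : ℂ) = j := by linear_combination h
    exact (Finset.mem_range.1 hi).ne (by exact_mod_cast hij)
  · rw [inv_Gamma_eq_prod_mul (j + 1), Finset.prod_range_succ]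
    push_cast
    ring

lemma analyticAt_Gamma {z : ℂ} (hz : ∀ j : ℕ, z ≠ -j) : AnalyticAt ℂ Complex.Gamma z := by
  have h : AnalyticAt ℂ (fun s => ((Complex.Gamma s)⁻¹)⁻¹) z :=
    (differentiable_one_div_Gamma.analyticAt z).inv (inv_ne_zero (Complex.Gamma_ne_zero hz))
  simpa using h

/-- The pole of `Γ` at a non-positive integer is simple. -/
lemma exists_sub_mul_Gamma_eq {k : ℕ} (hk : 1 ≤ k) {N j : ℕ} {s₀ : ℂ}
    (h : (k : ℂ) * s₀ - N = -j) :
    ∃ v : ℂ → ℂ, AnalyticAt ℂ v s₀ ∧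
      ∀ s, s ≠ s₀ → (s - s₀) * Complex.Gamma (k * s - N) = v s := by
  obtain ⟨u, hu, hu0, hueq⟩ := exists_inv_Gamma_eq_mul j
  have hk0 : (k : ℂ) ≠ 0 := by exact_mod_cast (by omega : k ≠ 0)
  have hlin : Differentiable ℂ fun s : ℂ => (k : ℂ) * s - N := by fun_prop
  refine ⟨fun s => (k * u (k * s - N))⁻¹, ?_, fun s hs => ?_⟩
  · exact (analyticAt_const.mul ((hu.comp hlin).analyticAt s₀)).inv
      (mul_ne_zero hk0 (by rwa [Function.comp_apply, h]))
  · have h1 := congrArg (·⁻¹) (hueq (k * s - N))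
    have h2 : (k : ℂ) * s - N + j = k * (s - s₀) := by linear_combination h
    simp only [inv_inv] at h1
    have h3 : s - s₀ ≠ 0 := sub_ne_zero.2 hs
    rw [h1, h2]
    dsimp only
    rw [mul_inv, mul_inv, mul_inv]
    field_simp

lemma exists_meromorphic_gammaRatio (N : ℕ) {k : ℕ} (hk : 1 ≤ k) :
    ∃ R : ℂ → ℂ,
      (∀ s : ℂ, (∀ j : ℕ, (k : ℂ) * s - N ≠ -j) →
        R s = Complex.Gamma (k * s - N) * (Complex.Gamma s)⁻¹) ∧
      MeromorphicOn R univ ∧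
      (∀ s, ¬ AnalyticAt ℂ R s → ∃ j : ℕ, (k : ℂ) * s - N = -j) ∧
      (∀ s₀, ∃ g, AnalyticAt ℂ g s₀ ∧ ∀ᶠ s in 𝓝[≠] s₀, (s - s₀) * R s = g s) ∧
      ∀ l : ℕ, AnalyticAt ℂ R (-l) := by
  set G : ℂ → ℂ := fun s => Complex.Gamma (k * s - N) * (Complex.Gamma s)⁻¹ with hG
  have hE := differentiable_one_div_Gamma
  have hana : ∀ s : ℂ, (∀ j : ℕ, (k : ℂ) * s - N ≠ -j) → AnalyticAt ℂ G s := fun s hs =>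
    ((analyticAt_Gamma hs).comp_of_eq
      ((analyticAt_const.mul analyticAt_id).sub analyticAt_const) rfl).mul (hE.analyticAt s)
  have hmer : MeromorphicOn G univ := by
    intro s _
    have h1 : MeromorphicAt (fun s : ℂ => ((Complex.Gamma (k * s - N))⁻¹)⁻¹) s := by
      have : Differentiable ℂ fun s : ℂ => (Complex.Gamma (k * s - N))⁻¹ :=
        hE.comp (by fun_prop : Differentiable ℂ fun s : ℂ => (k : ℂ) * s - N)
      exact (this.analyticAt s).meromorphicAt.inv
    simp only [inv_inv] at h1
    exact h1.mul (hE.analyticAt s).meromorphicAt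
  have hNF := meromorphicNFOn_toMeromorphicNFOn G univ
  have heqNE : ∀ s, toMeromorphicNFOn G univ =ᶠ[𝓝[≠] s] G := fun s =>
    hmer.toMeromorphicNFOn_eq_self_on_nhdsNE (mem_univ s)
  have heq : ∀ s g, AnalyticAt ℂ g s → G =ᶠ[𝓝[≠] s] g → toMeromorphicNFOn G univ =ᶠ[𝓝 s] g :=
    fun s g hg hGg => ((hNF (mem_univ s)).eventuallyEq_nhdsNE_iff_eventuallyEq_nhds
      hg.meromorphicNFAt).1 ((heqNE s).trans hGg)
  have hR : ∀ s : ℂ, (∀ j : ℕ, (k : ℂ) * s - N ≠ -j) → toMeromorphicNFOn G univ =ᶠ[𝓝 s] G :=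
    fun s hs => heq s G (hana s hs) .rfl
  refine ⟨toMeromorphicNFOn G univ, fun s hs => (hR s hs).self_of_nhds, hNF.meromorphicOn,
    fun s hs => ?_, fun s₀ => ?_, fun l => ?_⟩
  · by_contra! h
    exact hs ((hana s h).congr (hR s h).symm)
  · by_cases h : ∃ j : ℕ, (k : ℂ) * s₀ - N = -j
    · obtain ⟨j, hj⟩ := h
      obtain ⟨v, hv, hveq⟩ := exists_sub_mul_Gamma_eq hk hj
      refine ⟨fun s => v s * (Complex.Gamma s)⁻¹, hv.mul (hE.analyticAt s₀), ?_⟩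
      filter_upwards [heqNE s₀, self_mem_nhdsWithin] with s hs hs0
      rw [hs, hG, ← hveq s hs0, mul_assoc]
    · push Not at h
      refine ⟨fun s => (s - s₀) * G s, (analyticAt_id.sub analyticAt_const).mul (hana s₀ h), ?_⟩
      filter_upwards [heqNE s₀] with s hs
      rw [hs]
  · have hj : (k : ℂ) * (-l) - N = -((k * l + N : ℕ) : ℂ) := by
      push_cast
      ring
    obtain ⟨v, hv, hveq⟩ := exists_sub_mul_Gamma_eq hk hj
    obtain ⟨u, hu, -, hueq⟩ := exists_inv_Gamma_eq_mul l
    have hvu : AnalyticAt ℂ (fun s => v s * u s) (-l) := hv.mul (hu.analyticAt _)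
    refine hvu.congr (heq _ _ hvu ?_).symm
    filter_upwards [self_mem_nhdsWithin] with s hs0
    rw [hG, ← hveq s hs0]
    simp only [hueq s]
    ring

end

end

/-- Proposition 1: `𝒵_{N,n}(s,w,M)` has a meromorphic continuation to
`ℂ × {w | Re w_k > 0}`; for fixed `w`, poles in `s` have order at most `Z+1`
(expressed by analyticity of `(s-s₀)^{Z+2}·F`), occur only at real rationals
`a/b ≤ N/(n-Z)` with `n-Z ≤ b ≤ n`, and the continuation is analytic at
`(-ℓ, w)` for every non-negative integer `ℓ`. -/
theorem zetaIntegral_meromorphic_continuation {N n : ℕ} (hN : 0 < N) (hn : 0 < n)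
    (a : Fin N → Fin n → ℂ) (hH : HypH a) (Z : ℕ) (hZn : Z < n)
    (hrow : ∀ i, ((Finset.univ.filter fun j => a i j = 0).card ≤ Z)) :
    ∃ F : ℂ × (Fin n → ℂ) → ℂ,
      (∀ (s : ℂ) (w : Fin n → ℂ), (N : ℝ) / ((n : ℝ) - (Z : ℝ)) < s.re →
        (∀ k, 0 < (w k).re) → F (s, w) = zetaIntegral a s w) ∧
      (∀ w : Fin n → ℂ, (∀ k, 0 < (w k).re) →
        MeromorphicOn (fun s => F (s, w)) Set.univ ∧
        (∀ s₀ : ℂ, ¬ AnalyticAt ℂ (fun s => F (s, w)) s₀ →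
          s₀.im = 0 ∧ s₀.re ≤ (N : ℝ) / ((n : ℝ) - (Z : ℝ)) ∧
          ∃ A B : ℤ, (n : ℤ) - (Z : ℤ) ≤ B ∧ B ≤ (n : ℤ) ∧ s₀ = (A : ℂ) / (B : ℂ)) ∧
        (∀ s₀ : ℂ, AnalyticAt ℂ (fun s => (s - s₀) ^ (Z + 2) * F (s, w)) s₀)) ∧
      (∀ (l : ℕ) (w : Fin n → ℂ), (∀ k, 0 < (w k).re) →
        AnalyticAt ℂ F (-(l : ℂ), w)) := by
  obtain ⟨m, rfl⟩ : ∃ m, n = m + 1 := ⟨n - 1, by omega⟩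
  set q := m + 1 - Z with hq
  have hq1 : 1 ≤ q := by omega
  have hqm : q ≤ m + 1 := by omega
  have hqZ : ((m + 1 : ℕ) : ℝ) - Z = q := by rw [hq, Nat.cast_sub hZn.le]
  rw [hqZ]
  have hq0 : (0 : ℝ) < q := by exact_mod_cast hq1
  have hrow' : ∀ i, q ≤ (Finset.univ.filter fun j => a i j ≠ 0).card := fun i => by
    have h1 := Finset.card_filter_add_card_filter_not (s := Finset.univ) (fun j => a i j = 0)
    rw [Finset.card_univ, Fintype.card_fin] at h1
    have h2 := hrow i
    simp only [ne_eq]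
    omega
  obtain ⟨h, hana, hint⟩ := exists_analytic_orthant hN hq1 hqm hH.1 hrow'
  choose R hRval hRmer hRpole hRsimple hRneg using
    fun k : ℕ => exists_meromorphic_gammaRatio N (Nat.succ_pos k)
  set K := Finset.Ico (q - 1) (m + 1) with hK
  have hKcard : K.card = Z + 1 := by
    rw [hK, Nat.card_Ico]
    omega
  have hslice : ∀ s w, (∀ k, 0 < (w k).re) → AnalyticAt ℂ (fun s => h (s, w)) s :=
    fun s w hw => (hana (s, w) hw).comp_of_eq (analyticAt_id.prod analyticAt_const) rfl
  refine ⟨fun p => (∏ k ∈ K, R k p.1) * h p, fun s w hs hw => ?_, fun w hw => ⟨?_, ?_, ?_⟩,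
    fun l w hw => ?_⟩
  · have hs0 : 0 < s.re := (by positivity : (0 : ℝ) ≤ (N : ℝ) / q).trans_lt hs
    have hΓ : Complex.Gamma s ≠ 0 := Complex.Gamma_ne_zero_of_re_pos hs0
    have hset : {t : Fin N → ℝ | ∀ i, 0 < t i} = posOrthant N := by
      ext t
      simp [posOrthant]
    have hprod : gammaProd q N (m + 1) s = Complex.Gamma s ^ (m + 1) * ∏ k ∈ K, R k s := by
      have hKfilter : K = (Finset.range (m + 1)).filter fun k => q ≤ k + 1 := by
        ext k
        simp only [hK, Finset.mem_Ico, Finset.mem_filter, Finset.mem_range]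
        omega
      rw [hKfilter, Finset.prod_filter, gammaProd]
      nth_rw 2 [← Finset.card_range (m + 1)]
      rw [← Finset.prod_const, ← Finset.prod_mul_distrib]
      refine Finset.prod_congr rfl fun k _ => ?_
      split_ifs with hk
      · rw [hRval k s fun j hj => ?_]
        · push_cast
          field_simp
        · have h1 : (N : ℝ) < s.re * q := (div_lt_iff₀ hq0).1 hs
          have h2 : (q : ℝ) ≤ k + 1 := by exact_mod_cast hk
          have h3 := congrArg Complex.re hj
          simp at h3
          nlinarith [(Nat.cast_nonneg j : (0 : ℝ) ≤ j)]
      · rw [mul_one]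
    have h1 := hint s w hs hw
    rw [hprod, mul_assoc] at h1
    rw [zetaIntegral, hset]
    exact (mul_left_cancel₀ (pow_ne_zero _ hΓ) h1).symm
  · intro s hs
    exact (MeromorphicAt.fun_prod fun k _ => hRmer k s hs).mul (hslice s w hw).meromorphicAt
  · intro s₀ hs₀
    obtain ⟨k, hk, hRk⟩ : ∃ k ∈ K, ¬ AnalyticAt ℂ (R k) s₀ := by
      by_contra! hcon
      exact hs₀ ((Finset.analyticAt_fun_prod _ hcon).mul (hslice s₀ w hw))
    obtain ⟨j, hj⟩ := hRpole k s₀ hRk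
    have hk' := Finset.mem_Ico.1 hk
    have hk0 : ((k : ℝ) + 1) ≠ 0 := by positivity
    have hk0' : ((k : ℂ) + 1) ≠ 0 := by exact_mod_cast hk0
    have hs : s₀ = (((N - j : ℝ) / (k + 1) : ℝ) : ℂ) := by
      push_cast at hj ⊢
      rw [eq_div_iff hk0']
      linear_combination hj
    refine ⟨by rw [hs, ofReal_im], ?_, (N : ℤ) - j, (k : ℤ) + 1, by omega, by omega, ?_⟩
    · rw [hs, ofReal_re]
      have h2 : (q : ℝ) ≤ k + 1 := by exact_mod_cast (by omega : q ≤ k + 1)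
      calc (N - j : ℝ) / (k + 1) ≤ N / (k + 1) := by
            gcongr
            linarith [(Nat.cast_nonneg j : (0 : ℝ) ≤ j)]
        _ ≤ N / q := by gcongr
    · rw [hs]
      push_cast
      rfl
  · intro s₀
    choose g hg hgeq using fun k => hRsimple k s₀
    have hall : ∀ᶠ s in nhdsWithin s₀ {s₀}ᶜ, ∀ k ∈ K, (s - s₀) * R k s = g k s :=
      (Finset.eventually_all K).2 fun k _ => hgeq k
    have hG : AnalyticAt ℂ (fun s => (s - s₀) * ((∏ k ∈ K, g k s) * h (s, w))) s₀ :=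
      (analyticAt_id.sub analyticAt_const).mul
        ((Finset.analyticAt_fun_prod _ fun k _ => hg k).mul (hslice s₀ w hw))
    refine hG.congr ?_
    filter_upwards [eventually_nhdsWithin_iff.1 hall] with s hs
    rcases eq_or_ne s s₀ with rfl | hne
    · simp
    · rw [← Finset.prod_congr rfl (hs hne), Finset.prod_mul_distrib, Finset.prod_const, hKcard]
      ring
  · exact (Finset.analyticAt_fun_prod _ fun k _ =>
      (hRneg k l).comp_of_eq analyticAt_fst rfl).mul (hana _ hw)
end
end

section
/- Under Hypothesis H, for Re(s) > N/(n − Z_M) and Re(w_j) > 0 for all j, one has the identity Γ(s)^n · ζ_{N,n}(s,w,M) = ∫_{T ∈ (0,∞)^n} [Π_{j=1}^n e^{−w_j T_j} T_j^{s−1}] / [Π_{i=1}^N (1 − e^{−Σ_{j=1}^n a_{ij} T_j})] dT, where Γ is the complex Gamma function and the integral converges absolutely. -/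
open MeasureTheory Complex
open scoped Classical

noncomputable section

/-- `Z_M`: the maximal number of vanishing entries in a row. -/
def ZM {N n : ℕ} (a : Fin N → Fin n → ℂ) : ℕ :=
  Finset.univ.sup fun i => (Finset.univ.filter fun j => a i j = 0).card

/-- The Shintani–Barnes zeta series `ζ_{N,n}(s,w,M)`. -/
def zetaSeries {N n : ℕ} (a : Fin N → Fin n → ℂ) (s : ℂ) (w : Fin n → ℂ) : ℂ :=
  ∑' k : Fin N → ℕ, ∏ j, (w j + ∑ i, (k i : ℂ) * a i j) ^ (-s)

lemma summable_norm_and_hasSum_prod_pi {R ι : Type*} [NormedCommRing R] [CompleteSpace R] {N : ℕ}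
    (f : Fin N → ι → R) (hf : ∀ i, Summable fun k => ‖f i k‖) :
    (Summable fun k : Fin N → ι => ‖∏ i, f i (k i)‖) ∧
      HasSum (fun k : Fin N → ι => ∏ i, f i (k i)) (∏ i, ∑' k, f i k) := by
  induction N with
  | zero => exact ⟨(hasSum_fintype _).summable, by simp⟩
  | succ N ih =>
    obtain ⟨h1, h2⟩ := ih (fun i => f i.succ) (fun i => hf i.succ)
    constructor
    · rw [← (Fin.consEquiv fun _ : Fin (N + 1) => ι).summable_iff]
      refine ((hf 0).mul_norm h1).congr fun p => ?_
      simp [Fin.prod_univ_succ]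
    · rw [← (Fin.consEquiv fun _ : Fin (N + 1) => ι).hasSum_iff, Fin.prod_univ_succ]
      have := (summable_mul_of_summable_norm (hf 0) h1).hasSum
      rw [← tsum_mul_tsum_of_summable_norm (hf 0) h1, h2.tsum_eq] at this
      convert! this using 2 with p
      simp [Fin.prod_univ_succ]

lemma integrable_of_hasSum_of_summable_integral_norm {α ι E : Type*} [MeasurableSpace α]
    [NormedAddCommGroup E] [Countable ι] {μ : Measure α} {F : ι → α → E} {f : α → E}
    (hF : ∀ i, Integrable (F i) μ) (hsum : Summable fun i => ∫ x, ‖F i x‖ ∂μ)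
    (hf : AEStronglyMeasurable f μ) (h : ∀ᵐ x ∂μ, HasSum (fun i => F i x) (f x)) :
    Integrable f μ := by
  refine ⟨hf, ?_⟩
  calc ∫⁻ x, ‖f x‖ₑ ∂μ ≤ ∫⁻ x, ∑' i, ‖F i x‖ₑ ∂μ := by
        refine lintegral_mono_ae (h.mono fun x hx => ?_)
        rw [← hx.tsum_eq]
        exact enorm_tsum_le_tsum_enorm
    _ = ∑' i, ENNReal.ofReal (∫ x, ‖F i x‖ ∂μ) := by
        rw [lintegral_tsum fun i => (hF i).1.enorm]
        exact tsum_congr fun i => (ofReal_integral_norm_eq_lintegral_enorm (hF i)).symm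
    _ < ⊤ := hsum.tsum_ofReal_lt_top

lemma integrableOn_cpow_mul_exp_neg_mul_Ioi {s z : ℂ} (hs : 0 < s.re) (hz : 0 < z.re) :
    IntegrableOn (fun t : ℝ => (t : ℂ) ^ (s - 1) * cexp (-(z * t))) (Set.Ioi 0) := by
  have h := integrableOn_rpow_mul_exp_neg_mul_rpow (p := 1) (s := s.re - 1) (by linarith)
    one_pos hz
  refine Integrable.mono' h ?_ ?_
  · refine Measurable.aestronglyMeasurable ?_
    fun_prop
  · filter_upwards [ae_restrict_mem measurableSet_Ioi] with t ht
    rw [norm_mul, norm_cpow_eq_rpow_re_of_pos ht, Complex.norm_exp]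
    simp

lemma integral_norm_cpow_mul_exp_neg_mul_Ioi {s z : ℂ} (hs : 0 < s.re) (hz : 0 < z.re) :
    ∫ t : ℝ in Set.Ioi 0, ‖(t : ℂ) ^ (s - 1) * cexp (-(z * t))‖ =
      (1 / z.re) ^ s.re * Real.Gamma s.re := by
  rw [← Real.integral_rpow_mul_exp_neg_mul_Ioi hs hz]
  refine setIntegral_congr_fun measurableSet_Ioi fun t ht => ?_
  rw [norm_mul, norm_cpow_eq_rpow_re_of_pos ht, Complex.norm_exp]
  simp

lemma integral_cpow_mul_exp_neg_complex_mul_Ioi {s z : ℂ} (hs : 0 < s.re) (hz : 0 < z.re) :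
    ∫ t : ℝ in Set.Ioi 0, (t : ℂ) ^ (s - 1) * cexp (-(z * t)) = z ^ (-s) * Complex.Gamma s := by
  have hU : IsOpen {z : ℂ | 0 < z.re} := isOpen_lt continuous_const continuous_re
  have hL : AnalyticOnNhd ℂ
      (fun z : ℂ => ∫ t : ℝ in Set.Ioi 0, (t : ℂ) ^ (s - 1) * cexp (-(z * t)))
      {z : ℂ | 0 < z.re} := by
    refine DifferentiableOn.analyticOnNhd (fun u (hu : 0 < u.re) => ?_) hU
    have hV : {z : ℂ | u.re / 2 < z.re} ∈ nhds u :=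
      (isOpen_lt continuous_const continuous_re).mem_nhds (show u.re / 2 < u.re by linarith)
    have hb := integrableOn_rpow_mul_exp_neg_mul_rpow (p := 1) (s := s.re) (b := u.re / 2)
      (by linarith) one_pos (by linarith)
    refine (hasDerivAt_integral_of_dominated_loc_of_deriv_le
      (μ := volume.restrict (Set.Ioi 0))
      (F := fun z (t : ℝ) => (t : ℂ) ^ (s - 1) * cexp (-(z * t)))
      (F' := fun z (t : ℝ) => (t : ℂ) ^ (s - 1) * (cexp (-(z * t)) * (-t))) hV
      (Filter.Eventually.of_forall fun z => ?_)
      (integrableOn_cpow_mul_exp_neg_mul_Ioi hs hu) ?_ ?_ hb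
      ?_).2.differentiableAt.differentiableWithinAt
    · refine Measurable.aestronglyMeasurable ?_
      fun_prop
    · refine Measurable.aestronglyMeasurable ?_
      fun_prop
    · filter_upwards [ae_restrict_mem measurableSet_Ioi] with t (ht : 0 < t) z (hz : _ < z.re)
      rw [norm_mul, norm_mul, norm_cpow_eq_rpow_re_of_pos ht, Complex.norm_exp, norm_neg,
        Complex.norm_of_nonneg ht.le, Complex.sub_re, Complex.one_re, Real.rpow_sub_one ht.ne',
        Real.rpow_one]
      have : Real.exp (-(z * t)).re ≤ Real.exp (-(u.re / 2) * t) := by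
        apply Real.exp_le_exp.2
        simp only [neg_re, mul_re, ofReal_re, ofReal_im]
        nlinarith
      calc _ = t ^ s.re * Real.exp (-(z * t)).re := by field_simp
        _ ≤ _ := by gcongr
    · refine Filter.Eventually.of_forall fun t z _ => ?_
      have : HasDerivAt (fun z : ℂ => -(z * t)) (-(t : ℂ)) z := by
        simpa using! ((hasDerivAt_id z).mul_const (t : ℂ)).neg
      exact this.cexp.const_mul _
  have hR : AnalyticOnNhd ℂ (fun z : ℂ => z ^ (-s) * Complex.Gamma s) {z : ℂ | 0 < z.re} :=
    DifferentiableOn.analyticOnNhd (fun u (hu : 0 < u.re) =>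
      ((differentiableAt_id.cpow_const (Or.inl hu)).mul_const _).differentiableWithinAt) hU
  refine hL.eqOn_of_preconnected_of_frequently_eq hR
    (convex_halfSpace_re_gt 0).isPreconnected (z₀ := 1) (by simp) ?_ hz
  have hreal : ∀ r : ℝ, 0 < r →
      ∫ t : ℝ in Set.Ioi 0, (t : ℂ) ^ (s - 1) * cexp (-((r : ℂ) * t)) =
        (r : ℂ) ^ (-s) * Complex.Gamma s := fun r hr => by
    rw [Complex.integral_cpow_mul_exp_neg_mul_Ioi hs hr, one_div, cpow_neg,
      inv_cpow _ _ (by simp [arg_ofReal_of_nonneg hr.le, Real.pi_ne_zero.symm])]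
  have htend : Filter.Tendsto (fun r : ℝ => (r : ℂ)) (nhdsWithin 1 {1}ᶜ) (nhdsWithin 1 {1}ᶜ) := by
    refine tendsto_nhdsWithin_iff.2 ⟨?_, ?_⟩
    · exact (continuous_ofReal.tendsto' 1 1 (by simp)).mono_left nhdsWithin_le_nhds
    · filter_upwards [self_mem_nhdsWithin] with r hr
      simpa using hr
  refine htend.frequently (Filter.Eventually.frequently ?_)
  filter_upwards [nhdsWithin_le_nhds (lt_mem_nhds (zero_lt_one' ℝ))] with r hr
  exact hreal r hr

lemma ZM_lt {N n : ℕ} (hn : 0 < n) {a : Fin N → Fin n → ℂ} (hH : HypH a) : ZM a < n := by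
  refine (Finset.sup_lt_iff hn).2 fun i _ => ?_
  obtain ⟨j, hj⟩ := hH.2 i
  calc _ < (Finset.univ : Finset (Fin n)).card :=
        Finset.card_lt_card (Finset.filter_ssubset.2 ⟨j, Finset.mem_univ _, hj⟩)
    _ = n := by simp

lemma sub_ZM_le_card {N n : ℕ} (a : Fin N → Fin n → ℂ) (i : Fin N) :
    n - ZM a ≤ (Finset.univ.filter fun j => a i j ≠ 0).card := by
  have h1 : (Finset.univ.filter fun j => a i j = 0).card ≤ ZM a :=
    Finset.le_sup (f := fun i => (Finset.univ.filter fun j => a i j = 0).card)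
      (Finset.mem_univ i)
  have h2 := Finset.card_filter_add_card_filter_not (s := (Finset.univ : Finset (Fin n)))
    (fun j => a i j = 0)
  simp only [Finset.card_univ, Fintype.card_fin] at h2
  simp only [ne_eq]
  omega

lemma HypH.re_nonneg {N n : ℕ} {a : Fin N → Fin n → ℂ} (hH : HypH a) (i : Fin N) (j : Fin n) :
    0 ≤ (a i j).re := by
  rcases hH.1 i j with h | h
  · simp [h]
  · exact h.le

lemma HypH.exists_pos_le_re {N n : ℕ} {a : Fin N → Fin n → ℂ} (hH : HypH a) {w : Fin n → ℂ}
    (hw : ∀ j, 0 < (w j).re) :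
    ∃ c : ℝ, 0 < c ∧ (∀ j, c ≤ (w j).re) ∧ ∀ i j, a i j ≠ 0 → c ≤ (a i j).re := by
  obtain ⟨c₁, h₁⟩ := Finite.exists_ge fun j => (⟨(w j).re, hw j⟩ : {x : ℝ // 0 < x})
  obtain ⟨c₂, h₂⟩ := Finite.exists_ge fun p : {p : Fin N × Fin n // a p.1 p.2 ≠ 0} =>
    (⟨(a p.1.1 p.1.2).re, (hH.1 _ _).resolve_left p.2⟩ : {x : ℝ // 0 < x})
  exact ⟨min c₁ c₂, lt_min c₁.2 c₂.2, fun j => (min_le_left _ _).trans (h₁ j),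
    fun i j h => (min_le_right _ _).trans (h₂ ⟨(i, j), h⟩)⟩

lemma HypH.re_add_sum_pos {N n : ℕ} {a : Fin N → Fin n → ℂ} (hH : HypH a) {w : Fin n → ℂ}
    (hw : ∀ j, 0 < (w j).re) (k : Fin N → ℕ) (j : Fin n) :
    0 < (w j + ∑ i, (k i : ℂ) * a i j).re := by
  rw [add_re, re_sum]
  refine add_pos_of_pos_of_nonneg (hw j) (Finset.sum_nonneg fun i _ => ?_)
  simpa using mul_nonneg (Nat.cast_nonneg (k i)) (hH.re_nonneg i j)

lemma HypH.exists_le_prod_re {N n : ℕ} (hN : 0 < N) {a : Fin N → Fin n → ℂ} (hH : HypH a)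
    {w : Fin n → ℂ} (hw : ∀ j, 0 < (w j).re) :
    ∃ C : ℝ, 0 < C ∧ ∀ k : Fin N → ℕ, ∃ m : ℝ, 1 ≤ m ∧ (∏ i, ((k i : ℝ) + 1)) ≤ m ^ N ∧
      C * m ^ (n - ZM a) ≤ ∏ j, (w j + ∑ i, (k i : ℂ) * a i j).re := by
  obtain ⟨c, hc, hcw, hca⟩ := hH.exists_pos_le_re hw
  have : Nonempty (Fin N) := ⟨⟨0, hN⟩⟩
  refine ⟨c ^ n, by positivity, fun k => ?_⟩
  obtain ⟨i₀, hi₀⟩ := Finite.exists_max k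
  have hm : (1 : ℝ) ≤ (k i₀ : ℝ) + 1 := by simp
  refine ⟨(k i₀ : ℝ) + 1, hm, ?_, ?_⟩
  · calc ∏ i, ((k i : ℝ) + 1) ≤ ∏ _i : Fin N, ((k i₀ : ℝ) + 1) :=
        Finset.prod_le_prod (fun i _ => by positivity) fun i _ => by gcongr; exact hi₀ i
      _ = _ := by simp
  · calc c ^ n * ((k i₀ : ℝ) + 1) ^ (n - ZM a)
        ≤ c ^ n * ((k i₀ : ℝ) + 1) ^ (Finset.univ.filter fun j => a i₀ j ≠ 0).card := by
          gcongr
          exact sub_ZM_le_card a i₀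
      _ = ∏ j, c * (if a i₀ j ≠ 0 then (k i₀ : ℝ) + 1 else 1) := by
          rw [Finset.prod_mul_distrib, ← Finset.prod_filter, Finset.prod_const,
            Finset.prod_const, Finset.card_univ, Fintype.card_fin]
      _ ≤ _ := by
          refine Finset.prod_le_prod (fun j _ => by positivity) fun j _ => ?_
          have hnn : ∀ i ∈ Finset.univ, 0 ≤ ((k i : ℂ) * a i j).re := fun i _ => by
            simpa using mul_nonneg (Nat.cast_nonneg (k i)) (hH.re_nonneg i j)
          rw [add_re, re_sum]
          split_ifs with h
          · have h1 := Finset.single_le_sum hnn (Finset.mem_univ i₀)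
            have h2 : (k i₀ : ℝ) * c ≤ ((k i₀ : ℂ) * a i₀ j).re := by
              simpa using mul_le_mul_of_nonneg_left (hca i₀ j h) (Nat.cast_nonneg (k i₀))
            linarith [hcw j]
          · linarith [hcw j, Finset.sum_nonneg hnn]

lemma HypH.summable_prod_one_div_re_rpow {N n : ℕ} (hN : 0 < N) (hn : 0 < n)
    {a : Fin N → Fin n → ℂ} (hH : HypH a) {σ : ℝ} {w : Fin n → ℂ}
    (hσ : (N : ℝ) / ((n : ℝ) - (ZM a : ℝ)) < σ) (hw : ∀ j, 0 < (w j).re) :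
    Summable fun k : Fin N → ℕ => ∏ j, (1 / (w j + ∑ i, (k i : ℂ) * a i j).re) ^ σ := by
  have hZ := ZM_lt hn hH
  have hD : (0 : ℝ) < (n : ℝ) - ZM a := sub_pos.2 (Nat.cast_lt.2 hZ)
  have hN' : (0 : ℝ) < N := Nat.cast_pos.2 hN
  have hσ0 : 0 < σ := (div_pos hN' hD).trans hσ
  set p : ℝ := ((n : ℝ) - ZM a) * σ / N with hp
  have hp1 : 1 < p := by
    rw [hp, lt_div_iff₀ hN', one_mul]
    rwa [div_lt_iff₀' hD] at hσ
  obtain ⟨C, hC, hk⟩ := hH.exists_le_prod_re hN hw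
  have hsum := (summable_norm_and_hasSum_prod_pi
    (fun (_ : Fin N) (k : ℕ) => 1 / |(k : ℝ) + 1| ^ p)
    fun _ => ((Real.summable_one_div_nat_add_rpow 1 p).2 hp1).norm).2.summable
  refine Summable.of_nonneg_of_le (fun k => Finset.prod_nonneg fun j _ => ?_) (fun k => ?_)
    (hsum.mul_left (C⁻¹ ^ σ))
  · have := hH.re_add_sum_pos hw k j
    positivity
  · obtain ⟨m, hm1, hmN, hmle⟩ := hk k
    have hm0 : 0 < m := one_pos.trans_le hm1
    have hpos : 0 < ∏ i, ((k i : ℝ) + 1) := Finset.prod_pos fun i _ => by positivity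
    calc ∏ j, (1 / (w j + ∑ i, (k i : ℂ) * a i j).re) ^ σ
        = (∏ j, (w j + ∑ i, (k i : ℂ) * a i j).re)⁻¹ ^ σ := by
          rw [Real.finsetProd_rpow _ _ fun j _ =>
            one_div_nonneg.2 (hH.re_add_sum_pos hw k j).le]
          simp
      _ ≤ (C * m ^ (n - ZM a))⁻¹ ^ σ := by
          have : 0 < ∏ j, (w j + ∑ i, (k i : ℂ) * a i j).re :=
            Finset.prod_pos fun j _ => hH.re_add_sum_pos hw k j
          gcongr
      _ = C⁻¹ ^ σ * ((m ^ N)⁻¹) ^ p := by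
          rw [mul_inv, Real.mul_rpow (by positivity) (by positivity), ← inv_pow, ← inv_pow,
            ← Real.rpow_natCast, ← Real.rpow_natCast, ← Real.rpow_mul (by positivity),
            ← Real.rpow_mul (by positivity), Nat.cast_sub hZ.le, hp,
            mul_div_cancel₀ _ hN'.ne']
      _ ≤ C⁻¹ ^ σ * ((∏ i, ((k i : ℝ) + 1))⁻¹) ^ p := by gcongr
      _ = C⁻¹ ^ σ * ∏ i, 1 / |(k i : ℝ) + 1| ^ p := by
          rw [← Finset.prod_inv_distrib, ← Real.finsetProd_rpow _ _ fun i _ => by positivity]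
          congr 1
          refine Finset.prod_congr rfl fun i _ => ?_
          rw [abs_of_pos (by positivity), Real.inv_rpow (by positivity), one_div]

lemma HypH.hasSum_prod_cpow_mul_exp {N n : ℕ} {a : Fin N → Fin n → ℂ} (hH : HypH a) (s : ℂ)
    (w : Fin n → ℂ) {T : Fin n → ℝ} (hT : ∀ j, 0 < T j) :
    HasSum (fun k : Fin N → ℕ =>
        ∏ j, (T j : ℂ) ^ (s - 1) * cexp (-((w j + ∑ i, (k i : ℂ) * a i j) * T j)))
      ((∏ j, cexp (-(w j) * (T j : ℂ)) * (T j : ℂ) ^ (s - 1)) /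
        ∏ i, (1 - cexp (-∑ j, a i j * (T j : ℂ)))) := by
  have hq : ∀ i, ‖cexp (-∑ j, a i j * (T j : ℂ))‖ < 1 := fun i => by
    rw [Complex.norm_exp, Real.exp_lt_one_iff, neg_re, neg_lt_zero, re_sum]
    obtain ⟨j, hj⟩ := hH.2 i
    refine Finset.sum_pos' (fun j _ => ?_) ⟨j, Finset.mem_univ j, ?_⟩
    · simpa using mul_nonneg (hH.re_nonneg i j) (hT j).le
    · simpa using mul_pos ((hH.1 i j).resolve_left hj) (hT j)
  have h := (summable_norm_and_hasSum_prod_pi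
    (fun (i : Fin N) (k : ℕ) => cexp (-∑ j, a i j * (T j : ℂ)) ^ k)
    fun i => by simpa using summable_geometric_of_lt_one (norm_nonneg _) (hq i)).2
  simp only [tsum_geometric_of_norm_lt_one (hq _), Finset.prod_inv_distrib] at h
  rw [div_eq_mul_inv]
  convert! h.mul_left (∏ j, cexp (-(w j) * (T j : ℂ)) * (T j : ℂ) ^ (s - 1)) using 2 with k
  simp only [Finset.prod_mul_distrib, ← Complex.exp_nat_mul, ← Complex.exp_sum]
  rw [mul_comm (cexp _), mul_assoc, ← Complex.exp_add]
  congr 2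
  simp only [mul_neg, Finset.mul_sum, Finset.sum_neg_distrib, add_mul, Finset.sum_add_distrib,
    neg_add, neg_mul, Finset.sum_mul]
  rw [Finset.sum_comm]
  simp only [mul_assoc]

/-- The Gamma-integral representation: for `Re s > N/(n-Z_M)` and `Re w_j > 0`,
`Γ(s)^n · ζ_{N,n}(s,w,M) = ∫_{(0,∞)^n} (Π_j e^{-w_j T_j} T_j^{s-1}) /
(Π_i (1 - e^{-Σ_j a_{ij} T_j})) dT`, the integral being absolutely convergent. -/
theorem Gamma_pow_mul_zetaSeries_eq_integral {N n : ℕ} (hN : 0 < N) (hn : 0 < n)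
    (a : Fin N → Fin n → ℂ) (hH : HypH a) (s : ℂ) (w : Fin n → ℂ)
    (hs : (N : ℝ) / ((n : ℝ) - (ZM a : ℝ)) < s.re) (hw : ∀ j, 0 < (w j).re) :
    IntegrableOn (fun T : Fin n → ℝ =>
        (∏ j, Complex.exp (-(w j) * (T j : ℂ)) * (T j : ℂ) ^ (s - 1)) /
          ∏ i, (1 - Complex.exp (-∑ j, a i j * (T j : ℂ))))
      {T : Fin n → ℝ | ∀ j, 0 < T j} volume ∧
    Complex.Gamma s ^ n * zetaSeries a s w =
      ∫ T in {T : Fin n → ℝ | ∀ j, 0 < T j},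
        (∏ j, Complex.exp (-(w j) * (T j : ℂ)) * (T j : ℂ) ^ (s - 1)) /
          ∏ i, (1 - Complex.exp (-∑ j, a i j * (T j : ℂ))) := by
  have hσ : 0 < s.re := (div_pos (Nat.cast_pos.2 hN)
    (sub_pos.2 (Nat.cast_lt.2 (ZM_lt hn hH)))).trans hs
  have hset : {T : Fin n → ℝ | ∀ j, 0 < T j} = Set.univ.pi fun _ => Set.Ioi 0 := by
    ext T
    simp
  have hμ : (volume : Measure (Fin n → ℝ)).restrict {T | ∀ j, 0 < T j} =
      Measure.pi fun _ => (volume : Measure ℝ).restrict (Set.Ioi 0) := by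
    rw [hset, volume_pi, Measure.restrict_pi_pi]
  have hpos := hH.re_add_sum_pos hw
  have hsummable : Summable fun k : Fin N → ℕ => ∫ T in {T : Fin n → ℝ | ∀ j, 0 < T j},
      ‖∏ j, (T j : ℂ) ^ (s - 1) * cexp (-((w j + ∑ i, (k i : ℂ) * a i j) * T j))‖ := by
    refine ((hH.summable_prod_one_div_re_rpow hN hn hs hw).mul_right
      (Real.Gamma s.re ^ n)).congr fun k => ?_
    simp only [norm_prod]
    rw [hμ, integral_fintype_prod_eq_prod (fun j (t : ℝ) =>
      ‖(t : ℂ) ^ (s - 1) * cexp (-((w j + ∑ i, (k i : ℂ) * a i j) * t))‖)]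
    simp only [integral_norm_cpow_mul_exp_neg_mul_Ioi hσ (hpos k _), Finset.prod_mul_distrib,
      Finset.prod_const, Finset.card_univ, Fintype.card_fin]
  have hint : ∀ k : Fin N → ℕ, IntegrableOn (fun T : Fin n → ℝ =>
      ∏ j, (T j : ℂ) ^ (s - 1) * cexp (-((w j + ∑ i, (k i : ℂ) * a i j) * T j)))
      {T | ∀ j, 0 < T j} := fun k => by
    rw [IntegrableOn, hμ]
    exact Integrable.fintype_prod (f := fun j (t : ℝ) =>
      (t : ℂ) ^ (s - 1) * cexp (-((w j + ∑ i, (k i : ℂ) * a i j) * t)))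
      fun j => integrableOn_cpow_mul_exp_neg_mul_Ioi hσ (hpos k j)
  have hmeas : MeasurableSet {T : Fin n → ℝ | ∀ j, 0 < T j} := by
    rw [hset]
    exact MeasurableSet.univ_pi fun _ => measurableSet_Ioi
  have hHasSum : ∀ᵐ T ∂(volume.restrict {T : Fin n → ℝ | ∀ j, 0 < T j}), _ :=
    (ae_restrict_mem hmeas).mono fun T hT => hH.hasSum_prod_cpow_mul_exp s w hT
  refine ⟨integrable_of_hasSum_of_summable_integral_norm hint hsummable ?_ hHasSum, ?_⟩
  · refine Measurable.aestronglyMeasurable ?_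
    fun_prop
  · rw [← integral_congr_ae (hHasSum.mono fun T hT => hT.tsum_eq),
      ← integral_tsum_of_summable_integral_norm hint hsummable, zetaSeries, ← tsum_mul_left]
    refine tsum_congr fun k => ?_
    rw [hμ, integral_fintype_prod_eq_prod (fun j (t : ℝ) =>
      (t : ℂ) ^ (s - 1) * cexp (-((w j + ∑ i, (k i : ℂ) * a i j) * t)))]
    simp only [integral_cpow_mul_exp_neg_complex_mul_Ioi hσ (hpos k _), Finset.prod_mul_distrib,
      Finset.prod_const, Finset.card_univ, Fintype.card_fin]
    rw [mul_comm]
end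
end
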